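/- Let A_S be an Artin group of large type. Then the intersection of an arbitrary (possibly infinite) family of parabolic subgroups of A_S is itself a parabolic subgroup of A_S. -/

import Mathlib

/-- The alternating word `sts⋯` of length `k` in the free group on `S`. -/
def braidWord {S : Type*} (k : ℕ) (s t : S) : FreeGroup S :=
  ((List.range k).map fun i => FreeGroup.of (if i % 2 = 0 then s else t)).prod

/-- The braid relations of the Artin group with Coxeter-type matrix `M`
(`M s t = ⊤` means no relation). -/
def artinRels {S : Type*} (M : S → S → ℕ∞) : Set (FreeGroup S) :=
  { r | ∃ s t : S, s ≠ t ∧ ∃ k : ℕ, M s t = (k : ℕ∞) ∧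
      r = braidWord k s t * (braidWord k t s)⁻¹ }

/-- The Artin group associated to the matrix `M`. -/
abbrev ArtinGroup {S : Type*} (M : S → S → ℕ∞) : Type _ := PresentedGroup (artinRels M)

/-- The standard parabolic subgroup `A_X` generated by the images of elements of `X ⊆ S`. -/
def StandardParabolic {S : Type*} (M : S → S → ℕ∞) (X : Set S) : Subgroup (ArtinGroup M) :=
  Subgroup.closure ((fun s => (PresentedGroup.of s : ArtinGroup M)) '' X)

/-- The conjugate `g H g⁻¹` of a subgroup. -/
def conjSubgroup {G : Type*} [Group G] (g : G) (H : Subgroup G) : Subgroup G :=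
  H.map (MulAut.conj g).toMonoidHom

/-- A parabolic subgroup: a conjugate of a standard parabolic subgroup. -/
def IsParabolic {S : Type*} (M : S → S → ℕ∞) (P : Subgroup (ArtinGroup M)) : Prop :=
  ∃ (g : ArtinGroup M) (X : Set S), P = conjSubgroup g (StandardParabolic M X)

namespace LargeArtin

set_option linter.unusedSectionVars false

/-- The `n`-th letter of the infinite alternating word `s t s t ⋯`. -/
def altLetter {S : Type*} : S → S → ℕ → S
  | s, _, 0 => s
  | s, t, n + 1 => altLetter t s n

/-- The product of the first `n` letters of `s t s t ⋯`, read from right to left and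
evaluated through `g`. -/
def altProd {S G : Type*} [Group G] (g : S → G) (s t : S) : ℕ → G
  | 0 => 1
  | n + 1 => g (altLetter s t n) * altProd g s t n

section Alternating

variable {S G : Type*} [Group G]

@[simp] lemma altLetter_zero (s t : S) : altLetter s t 0 = s := rfl

lemma altLetter_succ (s t : S) (n : ℕ) : altLetter s t (n + 1) = altLetter t s n := rfl

@[simp] lemma altLetter_add_two (s t : S) (n : ℕ) : altLetter s t (n + 2) = altLetter s t n := rfl

lemma altLetter_pair (s t : S) (n : ℕ) :
    (altLetter s t n = s ∧ altLetter s t (n + 1) = t) ∨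
      (altLetter s t n = t ∧ altLetter s t (n + 1) = s) := by
  induction n generalizing s t with
  | zero => left; exact ⟨rfl, rfl⟩
  | succ n ih =>
    rcases ih t s with h | h
    · right; exact h
    · left; exact h

lemma altLetter_ne {s t : S} (h : s ≠ t) (n : ℕ) : altLetter s t n ≠ altLetter s t (n + 1) := by
  rcases altLetter_pair s t n with ⟨h1, h2⟩ | ⟨h1, h2⟩ <;> rw [h1, h2]
  · exact h
  · exact h.symm

lemma altLetter_add (s t : S) (a b : ℕ) :
    altLetter s t (a + b) = altLetter (altLetter s t a) (altLetter s t (a + 1)) b := by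
  induction a generalizing s t with
  | zero => simp [altLetter_succ]
  | succ a ih =>
    have := ih t s
    rw [show a + 1 + b = (a + b) + 1 by ring, altLetter_succ, this]; rfl

lemma altLetter_eq_ite (s t : S) (n : ℕ) : altLetter s t n = if n % 2 = 0 then s else t := by
  induction n generalizing s t with
  | zero => rfl
  | succ n ih =>
    rw [altLetter_succ, ih]
    rcases Nat.mod_two_eq_zero_or_one n with h | h
    · simp [h, Nat.add_mod]
    · simp [h, Nat.add_mod]

lemma altLetter_map {T : Type*} (φ : S → T) (s t : S) (n : ℕ) :
    φ (altLetter s t n) = altLetter (φ s) (φ t) n := by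
  induction n generalizing s t with
  | zero => rfl
  | succ n ih => exact ih t s

@[simp] lemma altProd_zero (g : S → G) (s t : S) : altProd g s t 0 = 1 := rfl

lemma altProd_succ (g : S → G) (s t : S) (n : ℕ) :
    altProd g s t (n + 1) = g (altLetter s t n) * altProd g s t n := rfl

lemma altProd_succ' (g : S → G) (s t : S) (n : ℕ) :
    altProd g s t (n + 1) = altProd g t s n * g s := by
  induction n with
  | zero => simp [altProd]
  | succ n ih => rw [altProd_succ, ih, ← mul_assoc]; rfl

lemma altProd_add (g : S → G) (s t : S) (a b : ℕ) :
    altProd g s t (a + b) =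
      altProd g (altLetter s t a) (altLetter s t (a + 1)) b * altProd g s t a := by
  induction b with
  | zero => simp
  | succ b ih => rw [← add_assoc, altProd_succ, ih, ← mul_assoc, altProd_succ, altLetter_add]

lemma map_altProd {H : Type*} [Group H] (φ : G →* H) (g : S → G) (s t : S) (n : ℕ) :
    φ (altProd g s t n) = altProd (fun x => φ (g x)) s t n := by
  induction n with
  | zero => simp
  | succ n ih => rw [altProd_succ, map_mul, ih, altProd_succ]

lemma altProd_comp {T : Type*} (g : T → G) (φ : S → T) (s t : S) (n : ℕ) :
    altProd g (φ s) (φ t) n = altProd (fun x => g (φ x)) s t n := by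
  induction n with
  | zero => simp
  | succ n ih => rw [altProd_succ, ih, altProd_succ, ← altLetter_map φ]

/-- For involutions, undoing an alternating product means reading it backwards. -/
lemma altProd_mul_altProd {g : S → G} (hg : ∀ s, g s * g s = 1) (s t : S) (n : ℕ) :
    altProd g (altLetter s t (n + 1)) (altLetter s t n) n * altProd g s t n = 1 := by
  induction n with
  | zero => simp
  | succ n ih =>
    rw [altProd_succ', altProd_succ, altLetter_add_two, mul_assoc, ← mul_assoc (g _) (g _), hg,
      one_mul, ih]

lemma lift_braidWord (g : S → G) (s t : S) (k : ℕ) :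
    FreeGroup.lift g (braidWord k s t) =
      altProd g (altLetter s t (k + 1)) (altLetter s t k) k := by
  induction k with
  | zero => simp [braidWord]
  | succ k ih =>
    have : braidWord (k + 1) s t = braidWord k s t * FreeGroup.of (altLetter s t k) := by
      simp [braidWord, List.range_succ, altLetter_eq_ite]
    rw [this, map_mul, ih, altProd_succ', altLetter_add_two, FreeGroup.lift_apply_of]

lemma lift_braidWord_eq_iff (g : S → G) (s t : S) (k : ℕ) :
    FreeGroup.lift g (braidWord k s t) = FreeGroup.lift g (braidWord k t s) ↔
      altProd g s t k = altProd g t s k := by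
  rw [lift_braidWord, lift_braidWord, altLetter_succ, altLetter_succ]
  have := altLetter_pair s t k
  rw [altLetter_succ] at this
  rcases this with ⟨h1, h2⟩ | ⟨h1, h2⟩ <;> rw [h1, h2]
  exact eq_comm

end Alternating

/-- The numbers `sin (nθ) / sin θ`, where `c = 2 cos θ`. -/
def coef (c : ℝ) : ℕ → ℝ
  | 0 => 0
  | 1 => 1
  | n + 2 => c * coef c (n + 1) - coef c n

section Coef

open Real

@[simp] lemma coef_zero (c : ℝ) : coef c 0 = 0 := rfl
@[simp] lemma coef_one (c : ℝ) : coef c 1 = 1 := rfl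
lemma coef_add_two (c : ℝ) (n : ℕ) : coef c (n + 2) = c * coef c (n + 1) - coef c n := rfl

lemma sin_mul_coef (θ : ℝ) (n : ℕ) :
    sin θ * coef (2 * cos θ) n = sin (n * θ) ∧
      sin θ * coef (2 * cos θ) (n + 1) = sin ((n + 1) * θ) := by
  induction n with
  | zero => simp
  | succ n ih =>
    refine ⟨by exact_mod_cast ih.2, ?_⟩
    rw [coef_add_two, mul_sub, ih.1]
    have h : sin θ * (2 * cos θ * coef (2 * cos θ) (n + 1)) = 2 * cos θ * sin ((n + 1) * θ) := by
      rw [← ih.2]; ring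
    rw [h]
    push_cast
    have e1 : ((n : ℝ) + 1 + 1) * θ = (n + 1) * θ + θ := by ring
    have e2 : (n : ℝ) * θ = (n + 1) * θ - θ := by ring
    rw [e1, e2, sin_add, sin_sub]; ring

lemma coef_two (n : ℕ) : coef 2 n = n ∧ coef 2 (n + 1) = n + 1 := by
  induction n with
  | zero => simp
  | succ n ih =>
    refine ⟨by exact_mod_cast ih.2, ?_⟩
    rw [coef_add_two, ih.1, ih.2]; push_cast; ring

variable {k : ℕ}

lemma sin_pi_div_pos (hk : 2 ≤ k) : 0 < sin (π / k) := by
  have : (2 : ℝ) ≤ k := by exact_mod_cast hk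
  apply sin_pos_of_pos_of_lt_pi (by positivity)
  rw [div_lt_iff₀ (by linarith)]
  nlinarith [pi_pos]

lemma coef_pos (hk : 2 ≤ k) {j : ℕ} (hj : 0 < j) (hjk : j < k) : 0 < coef (2 * cos (π / k)) j := by
  have h1 := (sin_mul_coef (π / k) j).1
  have h0 := sin_pi_div_pos hk
  have hk0 : (0 : ℝ) < k := by exact_mod_cast (by omega : 0 < k)
  have hj0 : (0 : ℝ) < j := by exact_mod_cast hj
  have h2 : 0 < sin (j * (π / k)) := by
    apply sin_pos_of_pos_of_lt_pi (by positivity)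
    have : (j : ℝ) < k := by exact_mod_cast hjk
    rw [← mul_div_assoc, div_lt_iff₀ hk0]
    nlinarith [pi_pos]
  rw [← h1] at h2
  exact (pos_iff_pos_of_mul_pos h2).1 h0

lemma coef_self (hk : 2 ≤ k) : coef (2 * cos (π / k)) k = 0 := by
  have h1 := (sin_mul_coef (π / k) k).1
  have h0 := sin_pi_div_pos hk
  have hk0 : (k : ℝ) ≠ 0 := by exact_mod_cast (by omega : k ≠ 0)
  rw [mul_div_cancel₀ _ hk0, sin_pi] at h1
  exact (mul_eq_zero.1 h1).resolve_left h0.ne'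

lemma coef_pred {j : ℕ} (hj : 1 ≤ j) : coef (2 * cos (π / ((j + 1 : ℕ) : ℝ))) j = 1 := by
  have h1 := (sin_mul_coef (π / ((j + 1 : ℕ) : ℝ)) j).1
  have h0 := sin_pi_div_pos (k := j + 1) (by omega)
  have hk0 : ((j + 1 : ℕ) : ℝ) ≠ 0 := by exact_mod_cast (by omega : j + 1 ≠ 0)
  have : (j : ℝ) * (π / ((j + 1 : ℕ) : ℝ)) = π - π / ((j + 1 : ℕ) : ℝ) := by
    field_simp; push_cast; ring
  rw [this, sin_pi_sub] at h1
  exact mul_left_cancel₀ h0.ne' (h1.trans (mul_one _).symm)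

lemma coef_nonneg (hk : 2 ≤ k) {j : ℕ} (hjk : j ≤ k) : 0 ≤ coef (2 * cos (π / k)) j := by
  rcases Nat.eq_zero_or_pos j with rfl | hj
  · simp
  rcases hjk.lt_or_eq with h | rfl
  · exact (coef_pos hk hj h).le
  · exact (coef_self hk).ge

end Coef

/-- The number `2 cos (π / n)`, with the convention `π / ∞ = 0`. -/
noncomputable def edge (n : ℕ∞) : ℝ := if n = ⊤ then 2 else 2 * Real.cos (Real.pi / n.toNat)

lemma edge_coe (k : ℕ) : edge k = 2 * Real.cos (Real.pi / k) := by simp [edge]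

lemma edge_top : edge ⊤ = 2 := by simp [edge]

lemma edge_lt_two {k : ℕ} (hk : 2 ≤ k) : edge k < 2 := by
  rw [edge_coe]
  have h1 := sin_pi_div_pos hk
  nlinarith [Real.sin_sq_add_cos_sq (Real.pi / k)]

lemma edge_injective {n m : ℕ∞} (hn : 2 ≤ n) (hm : 2 ≤ m) (h : edge n = edge m) : n = m := by
  induction n with
  | top =>
    induction m with
    | top => rfl
    | coe m =>
      have := edge_lt_two (k := m) (by exact_mod_cast hm)
      rw [edge_top] at h; linarith
  | coe n =>
    have hn' : 2 ≤ n := by exact_mod_cast hn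
    induction m with
    | top =>
      have := edge_lt_two hn'
      rw [edge_top] at h; linarith
    | coe m =>
      have hm' : 2 ≤ m := by exact_mod_cast hm
      rw [edge_coe, edge_coe] at h
      have hmem : ∀ k : ℕ, 2 ≤ k → Real.pi / k ∈ Set.Icc 0 Real.pi := by
        intro k hk
        have : (2 : ℝ) ≤ k := by exact_mod_cast hk
        refine ⟨by positivity, ?_⟩
        rw [div_le_iff₀ (by linarith)]
        nlinarith [Real.pi_pos]
      have h2 := Real.injOn_cos (hmem n hn') (hmem m hm') (by linarith)
      have hn0 : (n : ℝ) ≠ 0 := by exact_mod_cast (by omega : n ≠ 0)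
      have hm0 : (m : ℝ) ≠ 0 := by exact_mod_cast (by omega : m ≠ 0)
      have hpi := Real.pi_ne_zero
      field_simp at h2
      have : n = m := by exact_mod_cast h2.symm
      rw [this]

/-- A symmetric matrix all of whose off-diagonal entries are at least `3`. -/
class IsLargeType {S : Type*} (M : S → S → ℕ∞) : Prop where
  symm : ∀ s t, M s t = M t s
  three_le : ∀ s t, s ≠ t → 3 ≤ M s t

section Coxeter

variable {S : Type*}

lemma IsLargeType.two_le (M : S → S → ℕ∞) [IsLargeType M] {s t : S} (h : s ≠ t) : 2 ≤ M s t :=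
  le_trans (by norm_num) (IsLargeType.three_le s t h)

variable [Fintype S] [DecidableEq S] (M : S → S → ℕ∞)

/-- The Gram matrix (times two) of the canonical form of the Coxeter group of `M`. -/
noncomputable def gram (s t : S) : ℝ := if s = t then 2 else - edge (M s t)

@[simp] lemma gram_self (s : S) : gram M s s = 2 := by simp [gram]

lemma gram_of_ne {s t : S} (h : s ≠ t) : gram M s t = - edge (M s t) := by simp [gram, h]

lemma gram_symm [IsLargeType M] (s t : S) : gram M s t = gram M t s := by
  simp only [gram, eq_comm (a := s), IsLargeType.symm s t]

/-- The simple root of `s`. -/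
def simpleRoot (s : S) : S → ℝ := Pi.single s 1

/-- The simple coroot of `s`, a linear form. -/
noncomputable def coroot (s : S) : (S → ℝ) →ₗ[ℝ] ℝ := ∑ t, gram M s t • LinearMap.proj t

lemma coroot_apply (s : S) (v : S → ℝ) : coroot M s v = ∑ t, gram M s t * v t := by
  simp [coroot, LinearMap.sum_apply]

@[simp] lemma coroot_simpleRoot (s t : S) : coroot M s (simpleRoot t) = gram M s t := by
  simp [coroot_apply, simpleRoot, Pi.single_apply]

/-- The simple reflection of `s` in the canonical representation. -/
noncomputable def refl (s : S) : (S → ℝ) ≃ₗ[ℝ] (S → ℝ) :=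
  Module.reflection (show coroot M s (simpleRoot s) = 2 by simp)

lemma refl_apply (s : S) (v : S → ℝ) : refl M s v = v - coroot M s v • simpleRoot s :=
  Module.reflection_apply _ _

lemma refl_apply_of_ne {s t : S} (v : S → ℝ) (h : t ≠ s) : refl M s v t = v t := by
  simp [refl_apply, simpleRoot, h]

@[simp] lemma refl_refl (s : S) (v : S → ℝ) : refl M s (refl M s v) = v :=
  Module.involutive_reflection (show coroot M s (simpleRoot s) = 2 by simp) v

@[simp] lemma refl_mul_self (s : S) : refl M s * refl M s = 1 :=
  LinearEquiv.ext fun v => refl_refl M s v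

@[simp] lemma refl_simpleRoot_self (s : S) : refl M s (simpleRoot s) = - simpleRoot s := by
  rw [refl_apply, coroot_simpleRoot, gram_self, two_smul]; abel

lemma refl_simpleRoot {s t : S} (h : s ≠ t) :
    refl M s (simpleRoot t) = simpleRoot t + edge (M s t) • simpleRoot s := by
  rw [refl_apply, coroot_simpleRoot, gram_of_ne M h, neg_smul, sub_neg_eq_add]

/-- The canonical bilinear form. -/
noncomputable def form (v w : S → ℝ) : ℝ := ∑ s, v s * coroot M s w

lemma form_symm [IsLargeType M] (v w : S → ℝ) : form M v w = form M w v := by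
  simp only [form, coroot_apply, Finset.mul_sum]
  rw [Finset.sum_comm]
  refine Finset.sum_congr rfl fun s _ => Finset.sum_congr rfl fun t _ => ?_
  rw [gram_symm M t s]; ring

lemma form_simpleRoot (s : S) (w : S → ℝ) : form M (simpleRoot s) w = coroot M s w := by
  simp [form, simpleRoot, Pi.single_apply]

lemma form_sub (v v' w : S → ℝ) : form M (v - v') w = form M v w - form M v' w := by
  simp [form, sub_mul]

lemma form_smul (c : ℝ) (v w : S → ℝ) : form M (c • v) w = c * form M v w := by
  simp [form, Finset.mul_sum, mul_assoc]

lemma form_refl [IsLargeType M] (s : S) (v w : S → ℝ) :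
    form M (refl M s v) (refl M s w) = form M v w := by
  rw [refl_apply M s v, form_sub, form_smul, form_simpleRoot, form_symm M v (refl M s w),
    refl_apply, form_sub, form_smul, form_simpleRoot, map_sub, map_smul, coroot_simpleRoot,
    gram_self, form_symm M w v, smul_eq_mul]
  ring

variable {M}

lemma altProd_refl_simpleRoot [IsLargeType M] {s t : S} (h : s ≠ t) (n : ℕ) :
    altProd (refl M) t s n (simpleRoot s) =
      coef (edge (M s t)) (n + 1) • simpleRoot (altLetter s t n) +
        coef (edge (M s t)) n • simpleRoot (altLetter s t (n + 1)) := by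
  induction n with
  | zero => simp
  | succ n ih =>
    have hne := altLetter_ne h n
    have hc : M (altLetter s t (n + 1)) (altLetter s t n) = M s t := by
      rcases altLetter_pair s t n with ⟨h1, h2⟩ | ⟨h1, h2⟩ <;> rw [h1, h2]
      exact IsLargeType.symm t s
    rw [altProd_succ, LinearEquiv.mul_apply, ih, map_add, map_smul, map_smul,
      ← altLetter_succ s t n, refl_simpleRoot_self, refl_simpleRoot M hne.symm, hc,
      altLetter_add_two, coef_add_two]
    module

/-- The braid relations hold for the simple reflections. -/
lemma refl_braid [IsLargeType M] {s t : S} (h : s ≠ t) {m : ℕ} (hm : M s t = m) :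
    altProd (refl M) s t m = altProd (refl M) t s m := by
  have key : ∀ s t : S, s ≠ t → M s t = m →
      altProd (refl M) s t m (simpleRoot s) = altProd (refl M) t s m (simpleRoot s) := by
    intro s t h hm
    have hm2 : 2 ≤ m := by have := IsLargeType.two_le M h; rw [hm] at this; exact_mod_cast this
    obtain ⟨j, rfl⟩ : ∃ j, m = j + 1 := ⟨m - 1, by omega⟩
    have e1 : coef (edge (M s t)) (j + 1) = 0 := by rw [hm, edge_coe]; exact coef_self hm2
    have e2 : coef (edge (M s t)) j = 1 := by
      rw [hm, edge_coe]; exact coef_pred (by omega)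
    rw [altProd_refl_simpleRoot h, altProd_succ', LinearEquiv.mul_apply, refl_simpleRoot_self,
      map_neg, altProd_refl_simpleRoot h, coef_add_two, e1, e2]
    module
  have h1 := key s t h hm
  have h2 := key t s h.symm ((IsLargeType.symm t s).trans hm)
  have hm2 : 2 ≤ m := by have := IsLargeType.two_le M h; rw [hm] at this; exact_mod_cast this
  have hfix : ∀ (s t : S) (n : ℕ) (w : S → ℝ), coroot M s w = 0 → coroot M t w = 0 →
      altProd (refl M) s t n w = w := by
    intro s t n w h1 h2
    induction n with
    | zero => simp
    | succ n ih =>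
      rw [altProd_succ, LinearEquiv.mul_apply, ih, refl_apply]
      rcases altLetter_pair s t n with h | h <;> rw [h.1] <;> simp [h1, h2]
  have hc2 : edge (M s t) < 2 := by rw [hm]; exact edge_lt_two hm2
  have hc0 : 0 ≤ edge (M s t) := by
    rw [hm, edge_coe]
    have : coef (2 * Real.cos (Real.pi / m)) 2 = 2 * Real.cos (Real.pi / m) := by
      simp [coef]
    rw [← this]; exact coef_nonneg hm2 hm2
  refine LinearEquiv.ext fun v => ?_
  set c := edge (M s t)
  set a := coroot M s v
  set b := coroot M t v
  have hd : (4 - c ^ 2) ≠ 0 := by nlinarith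
  set x := (2 * a + c * b) / (4 - c ^ 2) with hx
  set y := (c * a + 2 * b) / (4 - c ^ 2) with hy
  have ht : gram M t s = -c := by rw [gram_symm, gram_of_ne M h]
  have hst : gram M s t = -c := gram_of_ne M h
  have hw1 : coroot M s (v - x • simpleRoot s - y • simpleRoot t) = 0 := by
    simp only [map_sub, map_smul, coroot_simpleRoot, gram_self, hst, smul_eq_mul]
    change a - _ - _ = 0
    rw [hx, hy]; field_simp; ring
  have hw2 : coroot M t (v - x • simpleRoot s - y • simpleRoot t) = 0 := by
    simp only [map_sub, map_smul, coroot_simpleRoot, gram_self, ht, smul_eq_mul]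
    change b - _ - _ = 0
    rw [hx, hy]; field_simp; ring
  have hv : v = (v - x • simpleRoot s - y • simpleRoot t) + x • simpleRoot s + y • simpleRoot t := by
    abel
  rw [hv]
  simp only [map_add, map_smul]
  rw [hfix s t m _ hw1 hw2, hfix t s m _ hw2 hw1, h1, h2]

variable (M)

/-- `g` is a product of `n` simple reflections. -/
def HasLength (g : (S → ℝ) ≃ₗ[ℝ] (S → ℝ)) (n : ℕ) : Prop :=
  ∃ l : List S, l.length = n ∧ (l.map (refl M)).prod = g

/-- The Coxeter group, acting through its canonical representation. -/
def IsCox (g : (S → ℝ) ≃ₗ[ℝ] (S → ℝ)) : Prop := ∃ n, HasLength M g n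

variable {M}

lemma HasLength.one : HasLength M 1 0 := ⟨[], rfl, rfl⟩

lemma HasLength.mul {g h : (S → ℝ) ≃ₗ[ℝ] (S → ℝ)} {n m : ℕ} (hg : HasLength M g n)
    (hh : HasLength M h m) : HasLength M (g * h) (n + m) := by
  obtain ⟨l, rfl, rfl⟩ := hg
  obtain ⟨l', rfl, rfl⟩ := hh
  exact ⟨l ++ l', by simp, by simp⟩

lemma HasLength.refl (s : S) : HasLength M (refl M s) 1 := ⟨[s], rfl, by simp⟩

lemma HasLength.altProd (s t : S) (n : ℕ) : HasLength M (altProd (LargeArtin.refl M) s t n) n := by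
  induction n with
  | zero => exact HasLength.one
  | succ n ih => rw [altProd_succ, add_comm]; exact (HasLength.refl _).mul ih

lemma IsCox.one : IsCox M 1 := ⟨0, HasLength.one⟩

lemma IsCox.mul {g h : (S → ℝ) ≃ₗ[ℝ] (S → ℝ)} (hg : IsCox M g) (hh : IsCox M h) :
    IsCox M (g * h) := by
  obtain ⟨n, hn⟩ := hg
  obtain ⟨m, hm⟩ := hh
  exact ⟨_, hn.mul hm⟩

lemma IsCox.refl (s : S) : IsCox M (refl M s) := ⟨1, HasLength.refl s⟩

lemma IsCox.form [IsLargeType M] {g : (S → ℝ) ≃ₗ[ℝ] (S → ℝ)} (hg : IsCox M g) (v w : S → ℝ) :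
    form M (g v) (g w) = LargeArtin.form M v w := by
  obtain ⟨n, l, -, rfl⟩ := hg
  induction l with
  | nil => simp
  | cons s l ih => simpa [form_refl] using ih

/-- An alternating word may be extended or shortened at its left end by a letter. -/
lemma refl_mul_altProd {x y z : S} {k : ℕ} (hz : z = x ∨ z = y) (hk : 1 ≤ k) :
    refl M z * altProd (refl M) x y k = altProd (refl M) x y (k + 1) ∨
      refl M z * altProd (refl M) x y k = altProd (refl M) x y (k - 1) := by
  obtain ⟨j, rfl⟩ : ∃ j, k = j + 1 := ⟨k - 1, by omega⟩
  have : z = altLetter x y (j + 1) ∨ z = altLetter x y j := by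
    rcases altLetter_pair x y j with h | h <;> rw [h.1, h.2] <;> tauto
  rcases this with rfl | rfl
  · left; rfl
  · right; rw [altProd_succ, ← mul_assoc, refl_mul_self, one_mul]; rfl

lemma nonneg_of_minimal [IsLargeType M] (n : ℕ) : ∀ (g : (S → ℝ) ≃ₗ[ℝ] (S → ℝ)) (s : S),
    HasLength M g n → (∀ m, HasLength M g m → n ≤ m) →
    (∀ m, HasLength M (g * refl M s) m → n ≤ m) → 0 ≤ g (simpleRoot s) := by
  induction n using Nat.strong_induction_on with
  | _ n IH =>
  intro g s hg hmin hs
  rcases Nat.eq_zero_or_pos n with rfl | hn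
  · obtain ⟨l, hl, rfl⟩ := hg
    rw [List.length_eq_zero_iff] at hl
    subst hl
    simp [simpleRoot]
  obtain ⟨t, g0, hg0, hgt⟩ : ∃ t g0, HasLength M g0 (n - 1) ∧ g = g0 * refl M t := by
    obtain ⟨l, rfl, rfl⟩ := hg
    have hl : l ≠ [] := by rintro rfl; simp at hn
    refine ⟨l.getLast hl, (l.dropLast.map (refl M)).prod, ⟨l.dropLast, by simp, rfl⟩, ?_⟩
    conv_lhs => rw [← List.dropLast_append_getLast hl]
    simp
  have hst : s ≠ t := by
    rintro rfl
    have : g * refl M s = g0 := by rw [hgt, mul_assoc, refl_mul_self, mul_one]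
    have := hs _ (this ▸ hg0)
    omega
  have hex : ∃ j, ∃ v k x y, HasLength M v j ∧ j + k = n ∧ ((x = s ∧ y = t) ∨ (x = t ∧ y = s)) ∧
      g = v * altProd (refl M) x y k :=
    ⟨n - 1, g0, 1, t, s, hg0, by omega, Or.inr ⟨rfl, rfl⟩, by simpa [altProd] using hgt⟩
  classical
  have hj1 : Nat.find hex ≤ n - 1 := Nat.find_min' hex
    ⟨g0, 1, t, s, hg0, by omega, Or.inr ⟨rfl, rfl⟩, by simpa [altProd] using hgt⟩
  have hjmin := fun i => @Nat.find_min _ _ hex i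
  obtain ⟨v, k, x, y, hv, hjk, hxy, hgv⟩ := Nat.find_spec hex
  generalize Nat.find hex = j at *
  have hk : 1 ≤ k := by omega
  obtain ⟨i, rfl⟩ : ∃ i, k = i + 1 := ⟨k - 1, by omega⟩
  rcases hxy with ⟨rfl, rfl⟩ | ⟨rfl, rfl⟩
  · have := hs (j + i) (by
      rw [hgv, altProd_succ', mul_assoc, mul_assoc, refl_mul_self, mul_one]
      exact hv.mul (HasLength.altProd _ _ _))
    omega
  have hvmin : ∀ m, HasLength M v m → j ≤ m := by
    intro m hm
    have := hmin (m + (i + 1)) (by rw [hgv]; exact hm.mul (HasLength.altProd _ _ _))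
    omega
  have hvz : ∀ z, z = x ∨ z = y → 0 ≤ v (simpleRoot z) := by
    intro z hz
    refine IH j (by omega) v z hv hvmin fun m hm => ?_
    by_contra hlt
    push Not at hlt
    have hg' : g = (v * refl M z) * (refl M z * altProd (refl M) x y (i + 1)) := by
      rw [hgv, mul_assoc, ← mul_assoc (refl M z), refl_mul_self, one_mul]
    rcases refl_mul_altProd (M := M) (x := x) (y := y) (k := i + 1) hz hk with h | h
    · rw [h] at hg'
      have := hmin (m + (i + 1 + 1)) (by rw [hg']; exact hm.mul (HasLength.altProd _ _ _))
      exact hjmin m hlt ⟨_, i + 1 + 1, x, y, hm, by omega, Or.inr ⟨rfl, rfl⟩, hg'⟩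
    · rw [h] at hg'
      have := hmin (m + (i + 1 - 1)) (by rw [hg']; exact hm.mul (HasLength.altProd _ _ _))
      omega
  have hcoef : 0 ≤ coef (edge (M y x)) (i + 1 + 1) ∧ 0 ≤ coef (edge (M y x)) (i + 1) := by
    have h2 := IsLargeType.two_le M hst
    rcases hM : M y x with _ | m
    · change 0 ≤ coef (edge ⊤) _ ∧ 0 ≤ coef (edge ⊤) _
      rw [edge_top, (coef_two _).1, (coef_two _).1]
      exact ⟨by positivity, by positivity⟩
    · change M y x = (m : ℕ∞) at hM
      change 0 ≤ coef (edge (m : ℕ∞)) _ ∧ 0 ≤ coef (edge (m : ℕ∞)) _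
      rw [hM] at h2
      have hm2 : 2 ≤ m := by exact_mod_cast h2
      have him : i + 1 < m := by
        by_contra hge
        push Not at hge
        obtain ⟨r, hr⟩ : ∃ r, i + 1 = m + r := ⟨i + 1 - m, by omega⟩
        obtain ⟨m', rfl⟩ : ∃ m', m = m' + 1 := ⟨m - 1, by omega⟩
        have := hs (j + (r + m')) (by
          rw [hgv, hr, altProd_add, ← refl_braid hst hM, altProd_succ' _ y x, mul_assoc, mul_assoc,
            mul_assoc, refl_mul_self, mul_one]
          exact hv.mul ((HasLength.altProd _ _ _).mul (HasLength.altProd _ _ _)))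
        omega
      rw [edge_coe]
      exact ⟨coef_nonneg hm2 him, coef_nonneg hm2 him.le⟩
  have hfin : ∀ n, 0 ≤ v (simpleRoot (altLetter y x n)) := by
    intro n
    rcases altLetter_pair y x n with h | h <;> rw [h.1] <;> apply hvz <;> tauto
  rw [hgv, LinearEquiv.mul_apply, altProd_refl_simpleRoot hst, map_add, map_smul, map_smul]
  exact add_nonneg (smul_nonneg hcoef.1 (hfin _)) (smul_nonneg hcoef.2 (hfin _))

/-- Every root is positive or negative. -/
lemma root_dichotomy [IsLargeType M] {g : (S → ℝ) ≃ₗ[ℝ] (S → ℝ)} (hg : IsCox M g) (s : S) :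
    0 ≤ g (simpleRoot s) ∨ g (simpleRoot s) ≤ 0 := by
  classical
  have hg' : IsCox M (g * refl M s) := hg.mul (IsCox.refl s)
  have e : g * refl M s * refl M s = g := by rw [mul_assoc, refl_mul_self, mul_one]
  rcases le_total (Nat.find hg) (Nat.find hg') with h | h
  · left
    exact nonneg_of_minimal _ g s (Nat.find_spec hg) (fun m hm => Nat.find_min' hg hm)
      fun m hm => h.trans (Nat.find_min' hg' hm)
  · right
    have := nonneg_of_minimal _ (g * refl M s) s (Nat.find_spec hg')
      (fun m hm => Nat.find_min' hg' hm)
      fun m hm => h.trans (Nat.find_min' hg (by rwa [e] at hm))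
    rw [LinearEquiv.mul_apply, refl_simpleRoot_self, map_neg] at this
    exact neg_nonneg.1 this

/-- A simple reflection permutes the positive roots other than its own simple root. -/
lemma refl_nonneg [IsLargeType M] {g : (S → ℝ) ≃ₗ[ℝ] (S → ℝ)} (hg : IsCox M g) {s x : S}
    (h0 : 0 ≤ g (simpleRoot x)) (hne : g (simpleRoot x) ≠ simpleRoot s) :
    0 ≤ refl M s (g (simpleRoot x)) := by
  rcases root_dichotomy ((IsCox.refl (M := M) s).mul hg) x with h | h
  · exact h
  exfalso
  rw [LinearEquiv.mul_apply] at h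
  set v := g (simpleRoot x) with hv
  have hvs : v = v s • simpleRoot s := by
    funext t
    by_cases hts : t = s
    · subst hts; simp [simpleRoot]
    · have h1 := h t
      rw [refl_apply_of_ne M v hts] at h1
      have := h0 t
      simp only [Pi.zero_apply] at h1 this
      simp [simpleRoot, hts]
      linarith
  have hn : form M v v = 2 := by rw [hv, hg.form, form_simpleRoot, coroot_simpleRoot, gram_self]
  have hn2 : form M v v = v s * (v s * 2) := by
    conv_lhs => rw [hvs]
    rw [form_smul, form_simpleRoot, map_smul, coroot_simpleRoot, gram_self, smul_eq_mul]
  have hs0 : 0 ≤ v s := h0 s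
  have : v s = 1 := by nlinarith
  rw [this, one_smul] at hvs
  exact hne hvs

end Coxeter

section Retraction

variable {S : Type*} [Fintype S] [DecidableEq S] {M : S → S → ℕ∞}

lemma HasLength.inv {g : (S → ℝ) ≃ₗ[ℝ] (S → ℝ)} {n : ℕ} (hg : HasLength M g n) :
    HasLength M g⁻¹ n := by
  obtain ⟨l, rfl, rfl⟩ := hg
  refine ⟨l.reverse, by simp, ?_⟩
  rw [List.prod_inv_reverse, List.map_map, List.map_reverse]
  congr 2

lemma IsCox.inv {g : (S → ℝ) ≃ₗ[ℝ] (S → ℝ)} (hg : IsCox M g) : IsCox M g⁻¹ := by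
  obtain ⟨n, hn⟩ := hg
  exact ⟨n, hn.inv⟩

variable (M) in
/-- The elements of the Coxeter group that are minimal in their left coset of the
parabolic subgroup of type `X`. -/
def MinRep (X : Set S) : Type _ :=
  {g : (S → ℝ) ≃ₗ[ℝ] (S → ℝ) // IsCox M g ∧ ∀ x ∈ X, 0 ≤ g (simpleRoot x)}

/-- The letter `s` moves `g` inside the coset of `g`. -/
def IsLoop (X : Set S) (g : (S → ℝ) ≃ₗ[ℝ] (S → ℝ)) (s : S) : Prop :=
  ∃ x ∈ X, g (simpleRoot x) = simpleRoot s

variable {X : Set S} {H : Type*} [Group H] (f : S → H)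

lemma simpleRoot_nonneg (s : S) : 0 ≤ simpleRoot s := by
  intro t
  by_cases h : t = s
  · subst h; simp [simpleRoot]
  · simp [simpleRoot, h]

lemma simpleRoot_injective : Function.Injective (simpleRoot : S → S → ℝ) := by
  intro s t h
  by_contra hne
  have := congrFun h s
  simp [simpleRoot, hne] at this

lemma not_nonneg_neg_simpleRoot (s : S) : ¬ (0 ≤ - simpleRoot s) := by
  intro h
  have := h s
  simp [simpleRoot] at this
  linarith

/-- Following an edge of the coset graph that is not a loop. -/
noncomputable def MinRep.step [IsLargeType M] (q : MinRep M X) (s : S) (h : ¬ IsLoop X q.1 s) :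
    MinRep M X :=
  ⟨refl M s * q.1, (IsCox.refl s).mul q.2.1, fun x hx =>
    refl_nonneg q.2.1 (q.2.2 x hx) fun he => h ⟨x, hx, he⟩⟩

lemma MinRep.not_isLoop_step (q : MinRep M X) (s : S) :
    ¬ IsLoop X (refl M s * q.1) s := by
  rintro ⟨x, hx, he⟩
  rw [LinearEquiv.mul_apply] at he
  have : q.1 (simpleRoot x) = - simpleRoot s := by
    rw [← refl_simpleRoot_self M s, ← he, refl_refl]
  exact not_nonneg_neg_simpleRoot s (this ▸ q.2.2 x hx)

open Classical in
/-- The action of a generator on pairs consisting of an element of `H` and a coset. -/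
noncomputable def genFun [IsLargeType M] (s : S) (p : H × MinRep M X) : H × MinRep M X :=
  if h : IsLoop X p.2.1 s then (f h.choose * p.1, p.2) else (p.1, p.2.step s h)

open Classical in
/-- The inverse of `genFun`. -/
noncomputable def genInv [IsLargeType M] (s : S) (p : H × MinRep M X) : H × MinRep M X :=
  if h : IsLoop X p.2.1 s then ((f h.choose)⁻¹ * p.1, p.2) else (p.1, p.2.step s h)

lemma MinRep.step_step [IsLargeType M] (q : MinRep M X) (s : S) (h : ¬ IsLoop X q.1 s)
    (h' : ¬ IsLoop X (q.step s h).1 s) : (q.step s h).step s h' = q := by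
  apply Subtype.ext
  change refl M s * (refl M s * q.1) = q.1
  rw [← mul_assoc, refl_mul_self, one_mul]

/-- The permutation by which a generator acts. -/
noncomputable def genPerm [IsLargeType M] (s : S) : Equiv.Perm (H × MinRep M X) where
  toFun := genFun f s
  invFun := genInv f s
  left_inv := by
    rintro ⟨h, q⟩
    by_cases hl : IsLoop X q.1 s
    · simp [genFun, genInv, hl]
    · have h2 : ¬ IsLoop X (q.step s hl).1 s := q.not_isLoop_step s
      simp [genFun, genInv, hl, h2, MinRep.step_step]
  right_inv := by
    rintro ⟨h, q⟩
    by_cases hl : IsLoop X q.1 s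
    · simp [genFun, genInv, hl]
    · have h2 : ¬ IsLoop X (q.step s hl).1 s := q.not_isLoop_step s
      simp [genFun, genInv, hl, h2, MinRep.step_step]

variable [IsLargeType M]

lemma genPerm_loop {s x : S} (hx : x ∈ X) (h : H) (q : MinRep M X)
    (he : q.1 (simpleRoot x) = simpleRoot s) : genPerm f s (h, q) = (f x * h, q) := by
  have hl : IsLoop X q.1 s := ⟨x, hx, he⟩
  change genFun f s (h, q) = _
  have : hl.choose = x := simpleRoot_injective (q.1.injective (hl.choose_spec.2.trans he.symm))
  simp [genFun, hl, this]

lemma genPerm_step {s : S} (h : H) (q : MinRep M X) (hl : ¬ IsLoop X q.1 s) :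
    genPerm f s (h, q) = (h, q.step s hl) := by
  change genFun f s (h, q) = _
  simp [genFun, hl]

lemma genPerm_step' {s : S} (h : H) (q : MinRep M X) (hl : ¬ IsLoop X q.1 s) :
    genPerm f s (h, q.step s hl) = (h, q) := by
  rw [genPerm_step f h _ (q.not_isLoop_step s)]
  exact congrArg (Prod.mk h) (q.step_step s hl _)

lemma altProd_genPerm_path (s t : S) (q : MinRep M X) (n : ℕ)
    (hn : ∀ j < n, ¬ IsLoop X (altProd (refl M) s t j * q.1) (altLetter s t j)) :
    ∃ q' : MinRep M X, q'.1 = altProd (refl M) s t n * q.1 ∧ ∀ h : H,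
      altProd (genPerm f) s t n (h, q) = (h, q') ∧
      altProd (genPerm f) (altLetter s t (n + 1)) (altLetter s t n) n (h, q') = (h, q) := by
  induction n with
  | zero => exact ⟨q, by simp, fun h => by simp⟩
  | succ n ih =>
    obtain ⟨q', hq', hh⟩ := ih fun j hj => hn j (by omega)
    have hl : ¬ IsLoop X q'.1 (altLetter s t n) := by rw [hq']; exact hn n (by omega)
    refine ⟨q'.step _ hl, ?_, fun h => ⟨?_, ?_⟩⟩
    · change refl M _ * q'.1 = _
      rw [hq', altProd_succ, mul_assoc]
    · rw [altProd_succ, Equiv.Perm.mul_apply, (hh h).1, genPerm_step f h q' hl]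
    · rw [altProd_succ', Equiv.Perm.mul_apply, altLetter_add_two, genPerm_step' f h q' hl, (hh h).2]

lemma altProd_genPerm_loops {s t x y : S} (hx : x ∈ X) (hy : y ∈ X) (q : MinRep M X)
    (hs : q.1 (simpleRoot x) = simpleRoot s) (ht : q.1 (simpleRoot y) = simpleRoot t) (h : H)
    (n : ℕ) : altProd (genPerm f) s t n (h, q) = (altProd f x y n * h, q) := by
  induction n with
  | zero => simp
  | succ n ih =>
    rw [altProd_succ, Equiv.Perm.mul_apply, ih, altProd_succ, mul_assoc]
    rcases Nat.mod_two_eq_zero_or_one n with h | h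
    · rw [altLetter_eq_ite, altLetter_eq_ite, if_pos h, if_pos h, genPerm_loop f hx _ _ hs]
    · rw [altLetter_eq_ite, altLetter_eq_ite, if_neg (by omega), if_neg (by omega),
        genPerm_loop f hy _ _ ht]

lemma edge_altLetter (s t : S) (n : ℕ) :
    edge (M (altLetter s t n) (altLetter s t (n + 1))) = edge (M s t) := by
  rcases altLetter_pair s t n with h | h <;> rw [h.1, h.2]
  rw [IsLargeType.symm (M := M) t s]

/-- In a rank two coset that is not a single point, one loop excludes others before
the opposite position. -/
lemma not_isLoop_of_isLoop {e e' x : S} (hne : e ≠ e') (q : MinRep M X)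
    (he : q.1 (simpleRoot x) = simpleRoot e) (he' : ¬ IsLoop X q.1 e') {m : ℕ}
    (hm : M e e' = m) {j : ℕ} (hj : j + 1 < m) :
    ¬ IsLoop X (altProd (refl M) e' e j * q.1) (altLetter e' e j) := by
  rintro ⟨y, hy, h⟩
  rcases Nat.eq_zero_or_pos j with rfl | hj0
  · exact he' ⟨y, hy, by simpa using h⟩
  set u := altLetter e' e j with hu
  set w := altLetter e' e (j + 1) with hw
  have huw : u ≠ w := altLetter_ne hne.symm j
  have h1 : q.1 (simpleRoot y) = altProd (refl M) w u j (simpleRoot u) := by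
    rw [← h, ← LinearEquiv.mul_apply, ← mul_assoc, hu, hw,
      altProd_mul_altProd (refl_mul_self M), one_mul]
  have hedge : edge (M u w) = edge m := by
    rw [hu, hw, edge_altLetter, IsLargeType.symm (M := M) e' e, hm]
  have hm2 : 2 ≤ m := by omega
  rw [altProd_refl_simpleRoot huw, hedge, edge_coe, hu, hw, ← altLetter_add, ← altLetter_add,
    ← two_mul] at h1
  have e0 : altLetter e' e (2 * j) = e' := by rw [altLetter_eq_ite, if_pos (by omega)]
  have e1 : altLetter e' e (j + (j + 1)) = e := by rw [altLetter_eq_ite, if_neg (by omega)]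
  rw [e0, e1] at h1
  have p0 := coef_pos hm2 hj0 (by omega : j < m)
  have p1 := coef_pos hm2 (Nat.succ_pos j) hj
  set a := coef (2 * Real.cos (Real.pi / m)) j
  set b := coef (2 * Real.cos (Real.pi / m)) (j + 1)
  have hxy : x ≠ y := by
    rintro rfl
    rw [he] at h1
    have := congrFun h1 e'
    simp [simpleRoot, hne.symm] at this
    linarith
  have h2 : b • q.1⁻¹ (simpleRoot e') = simpleRoot y - a • simpleRoot x := by
    have : q.1⁻¹ (q.1 (simpleRoot y)) = q.1⁻¹ (b • simpleRoot e' + a • q.1 (simpleRoot x)) := by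
      rw [h1, he]
    rw [map_add, map_smul, map_smul, ← LinearEquiv.mul_apply, ← LinearEquiv.mul_apply,
      inv_mul_cancel] at this
    simp only [LinearEquiv.coe_one, id_eq] at this
    rw [this]; abel
  have hd := root_dichotomy q.2.1.inv e'
  generalize q.1⁻¹ (simpleRoot e') = β at h2 hd
  have hx2 := congrFun h2 x
  have hy2 := congrFun h2 y
  simp [simpleRoot, hxy] at hx2
  simp [simpleRoot, hxy.symm] at hy2
  rcases hd with hd | hd
  · have := mul_nonneg p1.le (hd x)
    linarith
  · have := mul_nonpos_of_nonneg_of_nonpos p1.le (hd y)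
    linarith

variable (hf : ∀ x ∈ X, ∀ y ∈ X, x ≠ y → ∀ k : ℕ, M x y = k → altProd f x y k = altProd f y x k)

include hf

lemma genPerm_braid_of_isLoop {s t : S} (hst : s ≠ t) {m : ℕ} (hm : M s t = m) (h : H)
    (q : MinRep M X)
    (hl : ∃ k < m, IsLoop X (altProd (refl M) s t k * q.1) (altLetter s t k)) :
    altProd (genPerm f) s t m (h, q) = altProd (genPerm f) t s m (h, q) := by
  classical
  have hmin := fun i => @Nat.find_min _ _ hl i
  obtain ⟨hkm, x, hx, hxe⟩ := Nat.find_spec hl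
  generalize Nat.find hl = k at *
  have hno : ∀ j < k, ¬ IsLoop X (altProd (refl M) s t j * q.1) (altLetter s t j) :=
    fun j hj hlj => hmin j hj ⟨by omega, hlj⟩
  obtain ⟨qs, hqs, hpath⟩ := altProd_genPerm_path f s t q k hno
  rw [← hqs] at hxe
  by_cases hB : IsLoop X qs.1 (altLetter s t (k + 1))
  · obtain ⟨y, hy, hye⟩ := hB
    rcases k with _ | k
    · have hq : qs = q := Subtype.ext (by simpa using hqs)
      subst hq
      rw [altLetter_zero] at hxe
      rw [altLetter_succ, altLetter_zero] at hye
      rw [altProd_genPerm_loops f hx hy qs hxe hye, altProd_genPerm_loops f hy hx qs hye hxe]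
      have hxy : x ≠ y := by
        rintro rfl
        exact hst (simpleRoot_injective (hxe.symm.trans hye))
      have hMxy : M x y = m := by
        rw [← hm]
        refine edge_injective (IsLargeType.two_le M hxy) (IsLargeType.two_le M hst) ?_
        have := qs.2.1.form (simpleRoot x) (simpleRoot y)
        rw [hxe, hye, form_simpleRoot, form_simpleRoot, coroot_simpleRoot, coroot_simpleRoot,
          gram_of_ne M hst, gram_of_ne M hxy] at this
        linarith
      rw [hf x hx y hy hxy m hMxy]
    · exfalso
      rw [altLetter_add_two] at hye
      have hj := hno k (by omega)
      have h2 : qs.1 = refl M (altLetter s t k) * (altProd (refl M) s t k * q.1) := by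
        rw [hqs, altProd_succ, mul_assoc]
      obtain ⟨q', hq', -⟩ := altProd_genPerm_path f s t q k fun j hj => hno j (by omega)
      rw [← hq'] at h2
      exact q'.not_isLoop_step (altLetter s t k) ⟨y, hy, h2 ▸ hye⟩
  · set e := altLetter s t k with he
    set e' := altLetter s t (k + 1) with he'
    have hne : e ≠ e' := altLetter_ne hst k
    have hMe : M e e' = m := by
      rw [← hm]
      rcases altLetter_pair s t k with h | h <;> rw [he, he', h.1, h.2]
      exact IsLargeType.symm t s
    obtain ⟨r, rfl⟩ : ∃ r, m = k + r + 1 := ⟨m - k - 1, by omega⟩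
    have hm2 : 2 ≤ k + r + 1 := by
      have := IsLargeType.two_le M hst; rw [hm] at this; exact_mod_cast this
    have hno' : ∀ j < k + r, ¬ IsLoop X (altProd (refl M) e' e j * qs.1) (altLetter e' e j) :=
      fun j hj => not_isLoop_of_isLoop hne qs hxe hB hMe (by omega)
    obtain ⟨qr, hqr, hpr⟩ := altProd_genPerm_path f e' e qs r fun j hj => hno' j (by omega)
    obtain ⟨qe, hqe, hpe⟩ := altProd_genPerm_path f e' e qs (k + r) hno'
    have hloop : qe.1 (simpleRoot x) = simpleRoot (altLetter e' e (k + r)) := by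
      rw [hqe, LinearEquiv.mul_apply, hxe, altProd_refl_simpleRoot hne, hMe, edge_coe,
        coef_self hm2, coef_pred (by omega : 1 ≤ k + r), zero_smul, zero_add, one_smul,
        altLetter_succ]
    have left : altProd (genPerm f) s t (k + r + 1) (h, q) = (f x * h, qr) := by
      rw [add_assoc, altProd_add, Equiv.Perm.mul_apply, (hpath h).1, ← he, ← he', altProd_succ',
        Equiv.Perm.mul_apply, genPerm_loop f hx h qs hxe, (hpr _).1]
    have hts : altLetter e' e k = t ∧ altLetter e' e (k + 1) = s := by
      have h2 : altLetter e' e k = altLetter s t (k + 1 + k) := by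
        rw [altLetter_add s t (k + 1) k, altLetter_add_two]
      have h3 : altLetter e' e (k + 1) = altLetter s t (k + 1 + (k + 1)) := by
        rw [altLetter_add s t (k + 1) (k + 1), altLetter_add_two]
      rw [h2, h3, altLetter_eq_ite, altLetter_eq_ite, if_neg (by omega), if_pos (by omega)]
      exact ⟨rfl, rfl⟩
    have right : altProd (genPerm f) t s (k + r + 1) (h, q) = (f x * h, qr) := by
      have h1 : (h, q) = altProd (genPerm f) e' e k (h, qs) := (hpath h).2.symm
      rw [h1, ← Equiv.Perm.mul_apply, ← hts.1, ← hts.2, ← altProd_add,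
        show k + (k + r + 1) = (k + r) + 1 + k by ring, altProd_add, altProd_succ,
        Equiv.Perm.mul_apply, Equiv.Perm.mul_apply, (hpe h).1, genPerm_loop f hx h qe hloop]
      obtain ⟨q2, hq2, hp2⟩ := altProd_genPerm_path f (altLetter e' e r) (altLetter e' e (r + 1))
        qr k (fun j hj => by
          rw [hqr, ← mul_assoc, ← altProd_add, ← altLetter_add]
          exact hno' _ (by omega))
      have : q2 = qe := Subtype.ext (by
        rw [hq2, hqe, hqr, ← mul_assoc, ← altProd_add, add_comm])
      have h3 := (hp2 (f x * h)).2
      rw [this, ← altLetter_add, ← altLetter_add] at h3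
      rw [← h3]
      have a1 : altLetter e' e (k + r + 1) = altLetter e' e (r + (k + 1)) := by congr 1; ring
      have a2 : altLetter e' e (k + r + 1 + 1) = altLetter e' e (r + k) := by
        rw [altLetter_add_two, add_comm]
      rw [a1, a2]
    rw [left, right]

lemma genPerm_braid {s t : S} (hst : s ≠ t) {m : ℕ} (hm : M s t = m) :
    altProd (genPerm (M := M) (X := X) f) s t m = altProd (genPerm f) t s m := by
  refine Equiv.ext fun ⟨h, q⟩ => ?_
  by_cases h1 : ∃ k < m, IsLoop X (altProd (refl M) s t k * q.1) (altLetter s t k)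
  · exact genPerm_braid_of_isLoop f hf hst hm h q h1
  by_cases h2 : ∃ k < m, IsLoop X (altProd (refl M) t s k * q.1) (altLetter t s k)
  · exact (genPerm_braid_of_isLoop f hf hst.symm ((IsLargeType.symm t s).trans hm) h q h2).symm
  push Not at h1 h2
  obtain ⟨q1, hq1, hp1⟩ := altProd_genPerm_path f s t q m h1
  obtain ⟨q2, hq2, hp2⟩ := altProd_genPerm_path f t s q m h2
  rw [(hp1 h).1, (hp2 h).1]
  congr 1
  exact Subtype.ext (by rw [hq1, hq2, refl_braid hst hm])

/-- The action of the Artin group on `H × (cosets of the parabolic subgroup of type X)`. -/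
noncomputable def cosetAction : ArtinGroup M →* Equiv.Perm (H × MinRep M X) :=
  PresentedGroup.toGroup (f := genPerm f) (by
    rintro r ⟨s, t, hst, k, hk, rfl⟩
    rw [map_mul, map_inv, mul_inv_eq_one, lift_braidWord_eq_iff]
    exact genPerm_braid f hf hst hk)

@[simp] lemma cosetAction_of (s : S) : cosetAction f hf (PresentedGroup.of s) = genPerm f s :=
  PresentedGroup.toGroup.of _

omit hf [IsLargeType M] in
variable (M X) in
/-- The trivial coset. -/
def MinRep.base : MinRep M X := ⟨1, IsCox.one, fun x _ => simpleRoot_nonneg x⟩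

lemma cosetAction_of_base {x : S} (hx : x ∈ X) (h : H) :
    cosetAction f hf (PresentedGroup.of x) (h, MinRep.base M X) = (f x * h, MinRep.base M X) := by
  rw [cosetAction_of]
  exact genPerm_loop f hx h _ rfl

lemma cosetAction_mul_right (g : ArtinGroup M) (h c : H) (q : MinRep M X) :
    cosetAction f hf g (h * c, q) =
      ((cosetAction f hf g (h, q)).1 * c, (cosetAction f hf g (h, q)).2) := by
  have hs : ∀ s h (q : MinRep M X), genPerm f s (h * c, q) =
      ((genPerm f s (h, q)).1 * c, (genPerm f s (h, q)).2) := by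
    intro s h q
    by_cases hl : IsLoop X q.1 s
    · obtain ⟨x, hx, he⟩ := hl
      rw [genPerm_loop f hx _ _ he, genPerm_loop f hx _ _ he, mul_assoc]
    · rw [genPerm_step f _ _ hl, genPerm_step f _ _ hl]
  let R : Equiv.Perm (H × MinRep M X) := (Equiv.mulRight c).prodCongr (Equiv.refl _)
  have hg : g ∈ (Subgroup.centralizer {R}).comap (cosetAction f hf) := by
    have : (⊤ : Subgroup (ArtinGroup M)) ≤
        (Subgroup.centralizer {R}).comap (cosetAction f hf) := by
      rw [← PresentedGroup.closure_range_of, Subgroup.closure_le]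
      rintro _ ⟨s, rfl⟩
      simp only [Subgroup.coe_comap, Set.mem_preimage, SetLike.mem_coe,
        Subgroup.mem_centralizer_singleton_iff, cosetAction_of]
      refine Equiv.ext fun ⟨h, q⟩ => ?_
      exact hs s h q
    exact this trivial
  rw [Subgroup.mem_comap, Subgroup.mem_centralizer_singleton_iff] at hg
  exact Equiv.congr_fun hg (h, q)

lemma cosetAction_mem {Y : Set S} {g : ArtinGroup M} (hg : g ∈ StandardParabolic M Y) :
    (cosetAction f hf g (1, MinRep.base M X)).1 ∈ Subgroup.closure (f '' (X ∩ Y)) := by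
  set K := Subgroup.closure (f '' (X ∩ Y))
  let T : Set (H × MinRep M X) := {p | (∀ t ∉ Y, ∀ v, p.2.1 v t = v t) ∧ p.1 ∈ K}
  have hT : ∀ p, cosetAction f hf g p ∈ T ↔ p ∈ T := by
    induction hg using Subgroup.closure_induction with
    | mem g hg =>
      obtain ⟨s, hs, rfl⟩ := hg
      rintro ⟨h, q⟩
      simp only [cosetAction_of]
      by_cases hl : IsLoop X q.1 s
      · obtain ⟨x, hx, he⟩ := hl
        rw [genPerm_loop f hx _ _ he]
        refine and_congr_right fun hq => ?_
        have hxY : x ∈ Y := by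
          by_contra hxY
          have h2 := hq x hxY (simpleRoot x)
          simp only at h2
          rw [he] at h2
          have hsx : x ≠ s := fun h => hxY (h ▸ hs)
          simp [simpleRoot, hsx] at h2
        exact K.mul_mem_cancel_left (Subgroup.subset_closure ⟨x, ⟨hx, hxY⟩, rfl⟩)
      · rw [genPerm_step f _ _ hl]
        refine and_congr_left fun _ => forall₂_congr fun t ht => forall_congr' fun v => ?_
        have : t ≠ s := fun h => ht (h ▸ hs)
        simp [MinRep.step, refl_apply_of_ne M _ this]
    | one => simp
    | mul a b _ _ ha hb => intro p; rw [map_mul, Equiv.Perm.mul_apply, ha, hb]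
    | inv a _ ha =>
      intro p
      rw [← ha, ← Equiv.Perm.mul_apply, ← map_mul, mul_inv_cancel, map_one]; rfl
  refine ((hT _).2 ⟨fun t _ v => ?_, K.one_mem⟩).2
  simp [MinRep.base]

lemma cosetAction_base_snd {g : ArtinGroup M} (hg : g ∈ StandardParabolic M X) :
    ∀ h, (cosetAction f hf g (h, MinRep.base M X)).2 = MinRep.base M X := by
  induction hg using Subgroup.closure_induction with
  | mem g hg =>
    obtain ⟨s, hs, rfl⟩ := hg
    intro h
    simp only [cosetAction_of_base f hf hs]
  | one => simp
  | mul a b _ _ ha hb =>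
    intro h
    rw [map_mul, Equiv.Perm.mul_apply]
    rw [← Prod.mk.eta (p := cosetAction f hf b (h, MinRep.base M X)), hb, ha]
  | inv a _ ha =>
    intro h
    have hc : cosetAction f hf a
        (((cosetAction f hf a (1, MinRep.base M X)).1)⁻¹ * h, MinRep.base M X) =
          (h, MinRep.base M X) := by
      refine Prod.ext ?_ (ha _)
      rw [← one_mul (_⁻¹ * h), cosetAction_mul_right]
      simp
    rw [← hc, ← Equiv.Perm.mul_apply, ← map_mul, inv_mul_cancel, map_one]; rfl

/-- A standard parabolic subgroup has the universal property of the Artin group of its type. -/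
theorem exists_hom_of_braid : ∃ φ : StandardParabolic M X →* H,
    ∀ x (hx : x ∈ X), φ ⟨PresentedGroup.of x, Subgroup.subset_closure ⟨x, hx, rfl⟩⟩ = f x := by
  have key : ∀ g ∈ StandardParabolic M X, ∀ h, cosetAction f hf g (h, MinRep.base M X) =
      ((cosetAction f hf g (1, MinRep.base M X)).1 * h, MinRep.base M X) := by
    intro g hg h
    have := cosetAction_mul_right f hf g 1 h (MinRep.base M X)
    rw [one_mul] at this
    rw [this, cosetAction_base_snd f hf hg]
  refine ⟨⟨⟨fun g => (cosetAction f hf g.1 (1, MinRep.base M X)).1, by simp⟩, ?_⟩, ?_⟩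
  · rintro ⟨a, ha⟩ ⟨b, hb⟩
    simp only [MulMemClass.mk_mul_mk]
    rw [map_mul, Equiv.Perm.mul_apply, key b hb, key a ha, mul_one]
  · intro x hx
    simp only [MonoidHom.coe_mk, OneHom.coe_mk, cosetAction_of_base f hf hx, mul_one]

omit hf

lemma of_braid {s t : S} (hst : s ≠ t) {k : ℕ} (hk : M s t = k) :
    altProd (fun x => (PresentedGroup.of x : ArtinGroup M)) s t k =
      altProd (fun x => PresentedGroup.of x) t s k := by
  rw [← lift_braidWord_eq_iff]
  have : braidWord k s t * (braidWord k t s)⁻¹ ∈ artinRels M := ⟨s, t, hst, k, hk, rfl⟩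
  have h1 := PresentedGroup.one_of_mem this
  rw [map_mul, map_inv, mul_inv_eq_one] at h1
  have : (PresentedGroup.mk (artinRels M)) =
      FreeGroup.lift (fun x => (PresentedGroup.of x : ArtinGroup M)) := by
    ext x; simp [PresentedGroup.of]
  rw [← this]; exact h1

/-- Triple intersections of standard parabolic subgroups are tight. -/
theorem exists_mul_of_mem_mul {X Y Z : Set S} {y z : ArtinGroup M}
    (hy : y ∈ StandardParabolic M Y) (hz : z ∈ StandardParabolic M Z)
    (hx : y * z ∈ StandardParabolic M X) :
    ∃ u ∈ StandardParabolic M (X ∩ Y), ∃ w ∈ StandardParabolic M (X ∩ Z), y * z = u * w := by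
  let f : S → ArtinGroup M := fun s => PresentedGroup.of s
  have hf : ∀ x ∈ X, ∀ y ∈ X, x ≠ y → ∀ k : ℕ, M x y = k → altProd f x y k = altProd f y x k :=
    fun x _ y _ hxy k hk => of_braid hxy hk
  have hid : ∀ g ∈ StandardParabolic M X, ∀ h,
      cosetAction f hf g (h, MinRep.base M X) = (g * h, MinRep.base M X) := by
    intro g hg
    induction hg using Subgroup.closure_induction with
    | mem g hg =>
      obtain ⟨s, hs, rfl⟩ := hg
      exact fun h => cosetAction_of_base f hf hs h
    | one => simp
    | mul a b _ _ ha hb =>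
      intro h; rw [map_mul, Equiv.Perm.mul_apply, hb, ha, mul_assoc]
    | inv a _ ha =>
      intro h
      have := ha (a⁻¹ * h)
      rw [mul_inv_cancel_left] at this
      rw [← this, ← Equiv.Perm.mul_apply, ← map_mul, inv_mul_cancel, map_one]; rfl
  have hw := cosetAction_mem f hf hz
  have hu := cosetAction_mem f hf ((StandardParabolic M Y).inv_mem hy)
  refine ⟨_, Subgroup.inv_mem _ hu, _, hw, ?_⟩
  have h1 := hid _ hx 1
  rw [mul_one, map_mul, Equiv.Perm.mul_apply] at h1
  have h2 : cosetAction f hf z (1, MinRep.base M X) =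
      cosetAction f hf y⁻¹ (1 * (y * z), MinRep.base M X) := by
    rw [one_mul, ← h1, ← Equiv.Perm.mul_apply, ← map_mul, inv_mul_cancel, map_one]; rfl
  rw [cosetAction_mul_right] at h2
  rw [h2]
  simp

lemma StandardParabolic_empty : StandardParabolic M ∅ = ⊥ := by simp [StandardParabolic]

lemma StandardParabolic_mono {X Y : Set S} (h : X ⊆ Y) :
    StandardParabolic M X ≤ StandardParabolic M Y :=
  Subgroup.closure_mono (Set.image_mono h)

/-- Standard parabolic subgroups intersect in standard parabolic subgroups. -/
theorem StandardParabolic_inf (X Y : Set S) :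
    StandardParabolic M X ⊓ StandardParabolic M Y = StandardParabolic M (X ∩ Y) := by
  refine le_antisymm ?_ (le_inf (StandardParabolic_mono Set.inter_subset_left)
    (StandardParabolic_mono Set.inter_subset_right))
  rintro g ⟨hX, hY⟩
  obtain ⟨u, hu, w, hw, he⟩ := exists_mul_of_mem_mul (X := X) (Z := ∅) hY (Subgroup.one_mem _)
    (by rwa [mul_one])
  rw [Set.inter_empty, StandardParabolic_empty, Subgroup.mem_bot] at hw
  rw [mul_one, hw, mul_one] at he
  rwa [he]

end Retraction

section Systolic

universe u

variable {V : Type u}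

/-- Two vertices are equal or adjacent. -/
def Near (adj : V → V → Prop) (a b : V) : Prop := a = b ∨ adj a b

/-- Squares satisfying a condition have a diagonal. -/
def SquareFree (adj : V → V → Prop) (good : V → Prop) : Prop :=
  ∀ a b c d, good a → good b → good c → good d → adj a b → adj b c → adj c d → adj d a →
    Near adj a c ∨ Near adj b d

/-- Pentagons satisfying a condition have a diagonal. -/
def PentagonFree (adj : V → V → Prop) (good : V → Prop) : Prop :=
  ∀ a b c d e, good a → good b → good c → good d → good e →
    adj a b → adj b c → adj c d → adj d e → adj e a →
    Near adj a c ∨ Near adj b d ∨ Near adj c e ∨ Near adj d a ∨ Near adj e b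

/-- A covering of a flag complex, seen through its one-skeleton. -/
structure IsCovering (adj : V → V → Prop) {C : Type u} (adjC : C → C → Prop) (f : C → V) :
    Prop where
  symm : ∀ c c', adjC c c' → adjC c' c
  map : ∀ c c', adjC c c' → adj (f c) (f c')
  lift : ∀ c z, adj (f c) z → ∃ c', adjC c c' ∧ f c' = z
  unique : ∀ c c' c'', adjC c c' → adjC c c'' → f c' = f c'' → c' = c''
  triangle : ∀ c c' c'', adjC c c' → adjC c c'' → adj (f c') (f c'') → adjC c' c''

/-- Coverings have sections through every point. -/
def HasSections (adj : V → V → Prop) : Prop :=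
  ∀ (C : Type u) (adjC : C → C → Prop) (f : C → V), IsCovering adj adjC f → ∀ c₀ : C,
    ∃ σ : V → C, σ (f c₀) = c₀ ∧ (∀ v, f (σ v) = v) ∧ ∀ v w, adj v w → adjC (σ v) (σ w)

/-- A sphere in the universal covering, together with the labels of the neighbours of its
vertices in the previous sphere. -/
structure Sphere (V : Type u) where
  /-- the vertices -/
  T : Type u
  /-- the label of a vertex -/
  f : T → V
  /-- adjacency inside the sphere -/
  E : T → T → Prop
  /-- the labels of the neighbours in the previous sphere -/
  P : T → Set V

namespace Sphere

/-- The labels of the neighbours of a vertex that do not lie in the next sphere. -/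
def U (L : Sphere V) (s : L.T) : Set V := {z | z ∈ L.P s ∨ ∃ t, L.E s t ∧ L.f t = z}

/-- The neighbours, inside the sphere, of a new vertex labelled `z` attached to `s`. -/
def K (adj : V → V → Prop) (L : Sphere V) (s : L.T) (z : V) : Set L.T :=
  {t | (t = s ∨ L.E s t) ∧ adj (L.f t) z}

/-- The next sphere. -/
def next (adj : V → V → Prop) (L : Sphere V) : Sphere V where
  T := {u : V × Set L.T // ∃ s, adj (L.f s) u.1 ∧ u.1 ∉ L.U s ∧ u.2 = L.K adj s u.1}
  f := fun u => u.1.1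
  E := fun u u' => adj u.1.1 u'.1.1 ∧ ∃ t, t ∈ u.1.2 ∧ t ∈ u'.1.2
  P := fun u => L.f '' u.1.2

/-- The properties of spheres propagated by induction on the radius. -/
structure Good (adj : V → V → Prop) (L : Sphere V) : Prop where
  symm : ∀ s t, L.E s t → L.E t s
  map : ∀ s t, L.E s t → adj (L.f s) (L.f t)
  parent : ∀ s, ∀ w ∈ L.P s, adj w (L.f s)
  clique : ∀ s, ∀ w ∈ L.P s, ∀ w' ∈ L.P s, Near adj w w'
  inj : ∀ s t t', L.E s t → L.E s t' → L.f t = L.f t' → t = t'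
  common : ∀ s t, L.E s t → ∃ w, w ∈ L.P s ∧ w ∈ L.P t
  triangle : ∀ s t t', L.E s t → L.E s t' → adj (L.f t) (L.f t') → L.E t t'
  transfer : ∀ s t, L.E s t → ∀ w ∈ L.P s, adj w (L.f t) → w ∈ L.P t
  closed : ∀ s, ∀ w ∈ L.P s, ∀ z, adj z w → adj z (L.f s) → z ∈ L.U s
  disj : ∀ s t, L.E s t → L.f t ∉ L.P s

/-- The sphere of radius zero. -/
def zero (p : V) : Sphere V where
  T := PUnit
  f := fun _ => p
  E := fun _ _ => False
  P := fun _ => ∅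

lemma good_zero (adj : V → V → Prop) (p : V) : Good adj (zero p) := by
  constructor <;> simp [zero]

variable {adj : V → V → Prop} (hs : ∀ a b, adj a b → adj b a) (hi : ∀ a, ¬ adj a a)
  (h4 : ∀ v, SquareFree adj (adj v)) (h5 : ∀ v, PentagonFree adj (adj v))
  {L : Sphere V} (hL : Good adj L)

include hs h4 h5 hL

lemma E_of_mem_K {s t r : L.T} {z : V} (hz : adj (L.f s) z) (hU : z ∉ L.U s)
    (ht : L.E s t) (htz : adj (L.f t) z) (hr : L.E s r) (hrz : adj (L.f r) z) :
    r = t ∨ L.E t r := by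
  have hzP : ∀ w ∈ L.P s, ¬ Near adj z w := by
    rintro w hw (rfl | h)
    · exact hU (Or.inl hw)
    · exact hU (hL.closed s w hw z h (hs _ _ hz))
  have hsw : ∀ w ∈ L.P s, adj (L.f s) w := fun w hw => hs _ _ (hL.parent s w hw)
  have concl : Near adj (L.f t) (L.f r) → r = t ∨ L.E t r := by
    rintro (h | h)
    · exact Or.inl (hL.inj s _ _ hr ht h.symm)
    · exact Or.inr (hL.triangle s _ _ ht hr h)
  have fin : ∀ w ∈ L.P s, adj w (L.f t) → adj w (L.f r) → r = t ∨ L.E t r := by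
    intro w hw h1 h2
    rcases h4 (L.f s) (L.f t) z (L.f r) w (hL.map _ _ ht) hz (hL.map _ _ hr) (hsw w hw)
      htz (hs _ _ hrz) (hs _ _ h2) h1 with h | h
    · exact concl h
    · exact absurd h (hzP w hw)
  obtain ⟨w1, hw1, hw1t⟩ := hL.common s t ht
  obtain ⟨w2, hw2, hw2r⟩ := hL.common s r hr
  have e1 := hL.parent t w1 hw1t
  have e2 := hL.parent r w2 hw2r
  rcases hL.clique s w1 hw1 w2 hw2 with h | h
  · exact fin w1 hw1 e1 (h ▸ e2)
  rcases h5 (L.f s) (L.f t) z (L.f r) w2 w1 (hL.map _ _ ht) hz (hL.map _ _ hr) (hsw _ hw2)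
    (hsw _ hw1) htz (hs _ _ hrz) (hs _ _ e2) (hs _ _ h) e1 with h | h | h | h | h
  · exact concl h
  · exact absurd h (hzP _ hw2)
  · rcases h with h | h
    · exact absurd (h ▸ hw1) (hL.disj s r hr)
    · exact fin w1 hw1 e1 (hs _ _ h)
  · rcases h with h | h
    · exact absurd (h ▸ hw2) (hL.disj s t ht)
    · exact fin w2 hw2 h e2
  · refine absurd ?_ (hzP _ hw1)
    rcases h with h | h
    · exact Or.inl h.symm
    · exact Or.inr (hs _ _ h)

lemma K_eq {s t : L.T} {z : V} (hz : adj (L.f s) z) (hU : z ∉ L.U s)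
    (ht : t ∈ L.K adj s z) : adj (L.f t) z ∧ z ∉ L.U t ∧ L.K adj t z = L.K adj s z := by
  obtain ⟨rfl | hst, htz⟩ := ht
  · exact ⟨hz, hU, rfl⟩
  have hUt : z ∉ L.U t := by
    rintro (h | ⟨t', h1, rfl⟩)
    · exact hU (Or.inl (hL.transfer t s (hL.symm _ _ hst) z h (hs _ _ hz)))
    · exact hU (Or.inr ⟨t', hL.symm _ _
        (hL.triangle t t' s h1 (hL.symm _ _ hst) (hs _ _ hz)), rfl⟩)
  refine ⟨htz, hUt, Set.Subset.antisymm ?_ ?_⟩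
  · rintro r ⟨rfl | hr, hrz⟩
    · exact ⟨Or.inr hst, hrz⟩
    · exact ⟨E_of_mem_K hs h4 h5 hL htz hUt (hL.symm _ _ hst) hz hr hrz, hrz⟩
  · rintro r ⟨rfl | hr, hrz⟩
    · exact ⟨Or.inr (hL.symm _ _ hst), hrz⟩
    · exact ⟨E_of_mem_K hs h4 h5 hL hz hU hst htz hr hrz, hrz⟩

lemma next_spec (u : (L.next adj).T) {t : L.T} (ht : t ∈ u.1.2) :
    adj (L.f t) ((L.next adj).f u) ∧ (L.next adj).f u ∉ L.U t ∧
      u.1.2 = L.K adj t ((L.next adj).f u) := by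
  obtain ⟨s, hz, hU, hK⟩ := u.2
  rw [hK] at ht ⊢
  obtain ⟨h1, h2, h3⟩ := K_eq hs h4 h5 hL hz hU ht
  exact ⟨h1, h2, h3.symm⟩

include hi

lemma good_next : Good adj (L.next adj) := by
  have spec := fun u {t} => next_spec hs h4 h5 hL u (t := t)
  have mem : ∀ (u : (L.next adj).T) {t t' : L.T}, t ∈ u.1.2 → t' ∈ u.1.2 → t' = t ∨ L.E t t' := by
    intro u t t' ht ht'
    rw [(spec u ht).2.2] at ht'
    exact ht'.1
  have mem' : ∀ (u : (L.next adj).T) {t t' : L.T}, t ∈ u.1.2 → (t' = t ∨ L.E t t') →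
      adj (L.f t') ((L.next adj).f u) → t' ∈ u.1.2 := by
    intro u t t' ht h1 h2
    rw [(spec u ht).2.2]
    exact ⟨h1, h2⟩
  constructor
  · rintro u u' ⟨h, t, h1, h2⟩
    exact ⟨hs _ _ h, t, h2, h1⟩
  · rintro u u' ⟨h, -⟩
    exact h
  · rintro u _ ⟨t, ht, rfl⟩
    exact (spec u ht).1
  · rintro u _ ⟨t, ht, rfl⟩ _ ⟨t', ht', rfl⟩
    rcases mem u ht ht' with rfl | h
    · exact Or.inl rfl
    · exact Or.inr (hL.map _ _ h)
  · rintro u u' u'' ⟨h, t, h1, h2⟩ ⟨h', t2, h1', h2'⟩ he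
    have hK : t2 ∈ u'.1.2 := mem' u' h2 (mem u h1 h1') (he ▸ (spec u'' h2').1)
    refine Subtype.ext (Prod.ext he ?_)
    rw [(spec u' hK).2.2, (spec u'' h2').2.2, he]
  · rintro u u' ⟨h, t, h1, h2⟩
    exact ⟨L.f t, ⟨t, h1, rfl⟩, ⟨t, h2, rfl⟩⟩
  · rintro u u' u'' ⟨h, t, h1, h2⟩ ⟨h', t2, h1', h2'⟩ he
    refine ⟨he, ?_⟩
    rcases mem u h1 h1' with rfl | hE
    · exact ⟨t2, h2, h2'⟩
    rcases h4 ((L.next adj).f u) (L.f t) (L.f t2) ((L.next adj).f u'') ((L.next adj).f u')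
      (hs _ _ (spec u h1).1) (hs _ _ (spec u h1').1) h' h (hL.map _ _ hE) (spec u'' h2').1
      (hs _ _ he) (hs _ _ (spec u' h2).1) with (h3 | h3) | (h3 | h3)
    · exact absurd (Or.inr ⟨t, hL.symm _ _ hE, h3⟩) (spec u'' h2').2.1
    · exact ⟨t, h2, mem' u'' h2' (Or.inr (hL.symm _ _ hE)) h3⟩
    · exact absurd (Or.inr ⟨t2, hE, h3⟩) (spec u' h2).2.1
    · exact ⟨t2, mem' u' h2 (Or.inr hE) h3, h2'⟩
  · rintro u u' ⟨h, t, h1, h2⟩ _ ⟨t2, ht2, rfl⟩ h3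
    exact ⟨t2, mem' u' h2 (mem u h1 ht2) h3, rfl⟩
  · rintro u _ ⟨t, ht, rfl⟩ y hy1 hy2
    by_cases hyU : y ∈ L.U t
    · rcases hyU with hy | ⟨t', ht', rfl⟩
      · exact absurd (hL.closed t y hy _ (hs _ _ hy2) (hs _ _ (spec u ht).1)) (spec u ht).2.1
      · exact Or.inl ⟨t', mem' u ht (Or.inr ht') hy2, rfl⟩
    · exact Or.inr ⟨⟨(y, L.K adj t y), t, hs _ _ hy1, hyU, rfl⟩,
        ⟨hs _ _ hy2, t, ht, Or.inl rfl, hs _ _ hy1⟩, rfl⟩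
  · rintro u u' ⟨h, t, h1, h2⟩ ⟨t2, ht2, he⟩
    rcases mem u h1 ht2 with rfl | hE
    · have := (spec u' h2).1
      rw [he] at this
      exact hi _ this
    · exact (spec u' h2).2.1 (Or.inr ⟨t2, hE, he⟩)

end Sphere

variable {adj : V → V → Prop}

variable (adj) in
/-- The sphere of radius `n` in the universal covering. -/
def sphere (p : V) : ℕ → Sphere V
  | 0 => Sphere.zero p
  | n + 1 => (sphere p n).next adj

variable (adj) in
/-- Adjacency in the universal covering. -/
inductive CovAdj (p : V) : (Σ n, (sphere adj p n).T) → (Σ n, (sphere adj p n).T) → Prop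
  | same (n : ℕ) (s t : (sphere adj p n).T) (h : (sphere adj p n).E s t) : CovAdj p ⟨n, s⟩ ⟨n, t⟩
  | up (n : ℕ) (s : (sphere adj p n).T) (u : (sphere adj p (n + 1)).T) (h : s ∈ u.1.2) :
      CovAdj p ⟨n, s⟩ ⟨n + 1, u⟩
  | down (n : ℕ) (s : (sphere adj p n).T) (u : (sphere adj p (n + 1)).T) (h : s ∈ u.1.2) :
      CovAdj p ⟨n + 1, u⟩ ⟨n, s⟩

variable (hs : ∀ a b, adj a b → adj b a) (hi : ∀ a, ¬ adj a a)
  (h4 : ∀ v, SquareFree adj (adj v)) (h5 : ∀ v, PentagonFree adj (adj v))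

include hs hi h4 h5

lemma good_sphere (p : V) (n : ℕ) : Sphere.Good adj (sphere adj p n) := by
  induction n with
  | zero => exact Sphere.good_zero adj p
  | succ n ih => exact Sphere.good_next hs hi h4 h5 ih

lemma isCovering (p : V) :
    IsCovering adj (CovAdj adj p) (fun c : Σ n, (sphere adj p n).T => (sphere adj p c.1).f c.2) := by
  have good := good_sphere hs hi h4 h5 p
  have spec := fun n u {t} => Sphere.next_spec hs h4 h5 (good n) u (t := t)
  have mem : ∀ n (u : (sphere adj p (n + 1)).T) {t t' : (sphere adj p n).T}, t ∈ u.1.2 →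
      t' ∈ u.1.2 → t' = t ∨ (sphere adj p n).E t t' := by
    intro n u t t' ht ht'
    rw [(spec n u ht).2.2] at ht'
    exact ht'.1
  constructor
  · rintro _ _ (⟨n, s, t, h⟩ | ⟨n, s, u, h⟩ | ⟨n, s, u, h⟩)
    · exact CovAdj.same n _ _ ((good n).symm _ _ h)
    · exact CovAdj.down n _ _ h
    · exact CovAdj.up n _ _ h
  · rintro _ _ (⟨n, s, t, h⟩ | ⟨n, s, u, h⟩ | ⟨n, s, u, h⟩)
    · exact (good n).map _ _ h
    · exact (spec n u h).1
    · exact hs _ _ (spec n u h).1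
  · rintro ⟨n, s⟩ z hz
    by_cases hU : z ∈ (sphere adj p n).U s
    · rcases hU with hP | ⟨t, ht, rfl⟩
      · rcases n with _ | n
        · exact absurd hP (Set.notMem_empty z)
        · obtain ⟨t, ht, rfl⟩ := hP
          exact ⟨⟨n, t⟩, CovAdj.down n _ _ ht, rfl⟩
      · exact ⟨⟨n, t⟩, CovAdj.same n _ _ ht, rfl⟩
    · exact ⟨⟨n + 1, ⟨(z, (sphere adj p n).K adj s z), s, hz, hU, rfl⟩⟩,
        CovAdj.up n _ _ ⟨Or.inl rfl, hz⟩, rfl⟩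
  · intro c c' c'' h h' he
    cases h with
    | same n s t h =>
      cases h' with
      | same _ _ t' h' => rw [(good n).inj s t t' h h' he]
      | up _ _ u h' => exact absurd (Or.inr ⟨t, h, he⟩) (spec n u h').2.1
      | down n t' s h' =>
        exact absurd (show (sphere adj p (n + 1)).f t ∈ (sphere adj p (n + 1)).P s from
          ⟨t', h', he.symm⟩) ((good (n + 1)).disj s t h)
    | up n s u h =>
      cases h' with
      | same _ _ t h' => exact absurd (Or.inr ⟨t, h', he.symm⟩) (spec n u h).2.1
      | up _ _ u' h' =>
        have : u = u' := by
          refine Subtype.ext (Prod.ext he ?_)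
          rw [(spec n u h).2.2, (spec n u' h').2.2]
          exact congrArg _ he
        rw [this]
      | down n t' s h' =>
        exact absurd (Or.inl ⟨t', h', he.symm⟩) (spec (n + 1) u h).2.1
    | down n s u h =>
      cases h' with
      | same _ _ t h' =>
        exact absurd (show (sphere adj p (n + 1)).f t ∈ (sphere adj p (n + 1)).P u from
          ⟨s, h, he⟩) ((good (n + 1)).disj u t h')
      | up _ _ u' h' => exact absurd (Or.inl ⟨s, h, he⟩) (spec (n + 1) u' h').2.1
      | down _ s' _ h' =>
        rcases mem n u h h' with rfl | hE
        · rfl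
        · have := (good n).map _ _ hE
          simp only at he
          rw [he] at this
          exact absurd this (hi _)
  · intro c c' c'' h h' he
    cases h with
    | same n s t h =>
      cases h' with
      | same _ _ t' h' => exact CovAdj.same n _ _ ((good n).triangle s t t' h h' he)
      | up _ _ u h' =>
        refine CovAdj.up n _ _ ?_
        rw [(spec n u h').2.2]
        exact ⟨Or.inr h, he⟩
      | down n t' s h' =>
        refine CovAdj.down n _ _ ?_
        obtain ⟨-, r, hr1, hr2⟩ := h
        rw [(spec n t hr2).2.2]
        exact ⟨mem n s hr1 h', hs _ _ he⟩
    | up n s u h =>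
      cases h' with
      | same _ _ t h' =>
        refine CovAdj.down n _ _ ?_
        rw [(spec n u h).2.2]
        exact ⟨Or.inr h', hs _ _ he⟩
      | up _ _ u' h' => exact CovAdj.same (n + 1) _ _ ⟨he, s, h, h'⟩
      | down n t' s h' =>
        exact absurd ((good (n + 1)).closed s _ ⟨t', h', rfl⟩ _ he
          (hs _ _ (spec (n + 1) u h).1)) (spec (n + 1) u h).2.1
    | down n s u h =>
      cases h' with
      | same _ _ t h' =>
        refine CovAdj.up n _ _ ?_
        obtain ⟨-, r, hr1, hr2⟩ := h'
        rw [(spec n t hr2).2.2]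
        exact ⟨mem n u hr1 h, he⟩
      | up _ _ u' h' =>
        exact absurd ((good (n + 1)).closed u _ ⟨s, h, rfl⟩ _ (hs _ _ he)
          (hs _ _ (spec (n + 1) u' h').1)) (spec (n + 1) u' h').2.1
      | down _ s' _ h' =>
        rcases mem n u h h' with rfl | hE
        · exact absurd he (hi _)
        · exact CovAdj.same n _ _ hE

/-- Distance functions from a point, with systolic convexity properties. -/
structure IsRadial (adj : V → V → Prop) (p : V) (d : V → ℕ) : Prop where
  eq_zero : ∀ v, d v = 0 ↔ v = p
  le : ∀ v w, adj v w → d v ≤ d w + 1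
  exists_pred : ∀ v n, d v = n + 1 → ∃ w, adj w v ∧ d w = n
  clique : ∀ v w w', adj w v → adj w' v → d v = d w + 1 → d v = d w' + 1 → Near adj w w'
  common : ∀ v w, adj v w → d v = d w → ∃ r, adj r v ∧ adj r w ∧ d v = d r + 1

lemma exists_isRadial (hsec : HasSections adj) (p : V) : ∃ d, IsRadial adj p d := by
  have good := good_sphere hs hi h4 h5 p
  have spec := fun n u {t} => Sphere.next_spec hs h4 h5 (good n) u (t := t)
  have cov := isCovering hs hi h4 h5 p
  obtain ⟨σ, hσ0, hσ, hadj⟩ := hsec _ _ _ cov ⟨0, PUnit.unit⟩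
  have hinv : ∀ n (s : (sphere adj p n).T), σ ((sphere adj p n).f s) = ⟨n, s⟩ := by
    intro n
    induction n with
    | zero => exact fun s => hσ0
    | succ n ih =>
      intro u
      obtain ⟨t, ht, hU, hK⟩ := u.2
      have htu : t ∈ u.1.2 := by rw [hK]; exact ⟨Or.inl rfl, ht⟩
      refine cov.unique ⟨n, t⟩ _ _ ?_ (CovAdj.up n t u htu) (hσ _)
      rw [← ih t]
      exact hadj _ _ ht
  refine ⟨fun v => (σ v).1, ?_, ?_, ?_, ?_, ?_⟩
  · intro v
    constructor
    · intro h
      have h1 := hσ v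
      rcases hv : σ v with ⟨n, s⟩
      rw [hv] at h h1
      simp only at h
      subst h
      exact h1.symm
    · rintro rfl
      have : σ v = ⟨0, PUnit.unit⟩ := hσ0
      rw [this]
  · intro v w h
    have := hadj v w h
    generalize σ v = a at *
    generalize σ w = b at *
    cases this <;> simp only <;> omega
  · intro v n h
    have h1 := hσ v
    rcases hv : σ v with ⟨m, u⟩
    rw [hv] at h h1
    simp only at h
    subst h
    obtain ⟨t, ht, hU, hK⟩ := u.2
    refine ⟨(sphere adj p n).f t, ?_, by rw [hinv]⟩
    rw [← h1]
    exact ht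
  · intro v w w' h h' hd hd'
    have h1 := hadj v w (hs _ _ h)
    have h2 := hadj v w' (hs _ _ h')
    have e1 := hσ w
    have e2 := hσ w'
    generalize σ v = a at *
    generalize σ w = b at *
    generalize σ w' = b' at *
    subst e1 e2
    cases h1 with
    | same n s t h1 => simp at hd
    | up n s u h1 => simp only at hd; omega
    | down n s u h1 =>
      cases h2 with
      | same _ _ t h2 => simp at hd'
      | up _ _ u h2 => simp only at hd'; omega
      | down _ s' _ h2 => exact (good (n + 1)).clique u _ ⟨s, h1, rfl⟩ _ ⟨s', h2, rfl⟩
  · intro v w h hd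
    have h1 := hadj v w h
    have e1 := hσ v
    have e2 := hσ w
    generalize σ v = a at *
    generalize σ w = b at *
    subst e1 e2
    cases h1 with
    | up n s u h => simp only at hd; omega
    | down n s u h => simp only at hd; omega
    | same n s t hE =>
      rcases n with _ | n
      · exact absurd hE id
      · obtain ⟨-, r, hr1, hr2⟩ := hE
        exact ⟨(sphere adj p n).f r, (spec n s hr1).1, (spec n t hr2).1, by rw [hinv]⟩

lemma squareFree_of_hasSections (hsec : HasSections adj) : SquareFree adj fun _ => True := by
  rintro a b c d - - - - hab hbc hcd hda
  obtain ⟨f, hf⟩ := exists_isRadial hs hi h4 h5 hsec a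
  have ha : f a = 0 := (hf.eq_zero a).2 rfl
  have h1 : ∀ v, adj a v → f v = 1 := by
    intro v hv
    have h1 := hf.le v a (hs _ _ hv)
    have : f v ≠ 0 := fun h0 => hi a (by rwa [(hf.eq_zero v).1 h0] at hv)
    omega
  have hb := h1 b hab
  have hd := h1 d (hs _ _ hda)
  have hc := hf.le c b (hs _ _ hbc)
  obtain h | h | h : f c = 0 ∨ f c = 1 ∨ f c = 2 := by omega
  · exact Or.inl (Or.inl ((hf.eq_zero c).1 h).symm)
  · obtain ⟨w, hw, hw0⟩ := hf.exists_pred c 0 h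
    rw [(hf.eq_zero w).1 hw0] at hw
    exact Or.inl (Or.inr hw)
  · exact Or.inr (hf.clique c b d hbc (hs _ _ hcd) (by omega) (by omega))

lemma pentagonFree_of_hasSections (hsec : HasSections adj) : PentagonFree adj fun _ => True := by
  rintro a b c d e - - - - - hab hbc hcd hde hea
  obtain ⟨f, hf⟩ := exists_isRadial hs hi h4 h5 hsec a
  have ha : f a = 0 := (hf.eq_zero a).2 rfl
  have h1 : ∀ v, adj a v → f v = 1 := by
    intro v hv
    have h1 := hf.le v a (hs _ _ hv)
    have : f v ≠ 0 := fun h0 => hi a (by rwa [(hf.eq_zero v).1 h0] at hv)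
    omega
  have hnear : ∀ v, f v ≤ 1 → Near adj a v := by
    intro v hv
    obtain h | h : f v = 0 ∨ f v = 1 := by omega
    · exact Or.inl ((hf.eq_zero v).1 h).symm
    · obtain ⟨w, hw, hw0⟩ := hf.exists_pred v 0 h
      rw [(hf.eq_zero w).1 hw0] at hw
      exact Or.inr hw
  have hb := h1 b hab
  have he := h1 e (hs _ _ hea)
  have hc := hf.le c b (hs _ _ hbc)
  have hd := hf.le d e hde
  by_cases hc1 : f c ≤ 1
  · exact Or.inl (hnear c hc1)
  by_cases hd1 : f d ≤ 1
  · refine Or.inr (Or.inr (Or.inr (Or.inl ?_)))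
    rcases hnear d hd1 with h | h
    · exact Or.inl h.symm
    · exact Or.inr (hs _ _ h)
  obtain ⟨w, hwc, hwd, hw⟩ := hf.common c d hcd (by omega)
  have hw1 : f w = 1 := by omega
  have haw : adj w a := by
    rcases hnear w hw1.le with h | h
    · rw [← h] at hw1; omega
    · exact hs _ _ h
  rcases hf.clique c b w hbc hwc (by omega) (by omega) with h | hbw
  · exact Or.inr (Or.inl (Or.inr (h ▸ hwd)))
  rcases hf.clique d e w (hs _ _ hde) hwd (by omega) (by omega) with h | hew
  · exact Or.inr (Or.inr (Or.inl (Or.inr (hs _ _ (h ▸ hwc)))))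
  exact h5 w a b c d e haw (hs _ _ hbw) hwc hwd (hs _ _ hew) hab hbc hcd hde hea

end Systolic

section CosetGraph

universe u

variable {G : Type u} [Group G] {I : Type u} (H : I → Subgroup G)

/-- The vertices of the coset graph of a family of subgroups: the left cosets. -/
def CosetVertex : Type u := Σ i, G ⧸ H i

variable {H}

/-- The left coset of `g`. -/
def CosetVertex.of (i : I) (g : G) : CosetVertex H := ⟨i, (g : G ⧸ H i)⟩

lemma CosetVertex.of_eq_of {i : I} {g h : G} :
    (CosetVertex.of i g : CosetVertex H) = CosetVertex.of i h ↔ g⁻¹ * h ∈ H i := by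
  rw [← QuotientGroup.eq]
  constructor
  · intro e
    exact eq_of_heq (Sigma.mk.inj e).2
  · intro e
    exact congrArg (Sigma.mk i) e

lemma CosetVertex.exists_of (v : CosetVertex H) : ∃ g, v = CosetVertex.of v.1 g := by
  obtain ⟨i, q⟩ := v
  obtain ⟨g, rfl⟩ := QuotientGroup.mk_surjective q
  exact ⟨g, rfl⟩

variable (H) in
/-- Left cosets of distinct subgroups are adjacent when they intersect. -/
def cosetAdj (v w : CosetVertex H) : Prop :=
  v.1 ≠ w.1 ∧ ∃ g, v = CosetVertex.of v.1 g ∧ w = CosetVertex.of w.1 g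

lemma cosetAdj_symm (v w : CosetVertex H) (h : cosetAdj H v w) : cosetAdj H w v :=
  ⟨h.1.symm, h.2.imp fun _ => And.symm⟩

lemma cosetAdj_irrefl (v : CosetVertex H) : ¬ cosetAdj H v v := fun h => h.1 rfl

lemma cosetAdj_of {i j : I} (hij : i ≠ j) (g : G) :
    cosetAdj H (CosetVertex.of i g) (CosetVertex.of j g) := ⟨hij, g, rfl, rfl⟩

lemma near_iff {v w : CosetVertex H} :
    Near (cosetAdj H) v w ↔ ∃ g, v = CosetVertex.of v.1 g ∧ w = CosetVertex.of w.1 g := by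
  constructor
  · rintro (rfl | h)
    · obtain ⟨g, hg⟩ := v.exists_of
      exact ⟨g, hg, hg⟩
    · exact h.2
  · rintro ⟨g, hv, hw⟩
    by_cases h : v.1 = w.1
    · left; rw [hv, hw, h]
    · exact Or.inr ⟨h, g, hv, hw⟩

/-- A lift of the chamber of `b` to a covering. -/
structure ChamberLift {C : Type u} (adjC : C → C → Prop) (f : C → CosetVertex H) : Type u where
  /-- the underlying group element -/
  b : G
  /-- the lifted vertices -/
  γ : I → C
  spec : ∀ i, f (γ i) = CosetVertex.of i b
  adj : ∀ i j, i ≠ j → adjC (γ i) (γ j)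

variable {C : Type u} {adjC : C → C → Prop} {f : C → CosetVertex H}

lemma ChamberLift.ext' (hC : IsCovering (cosetAdj H) adjC f) {e e' : ChamberLift adjC f} (i : I)
    (hb : e.b = e'.b) (hi : e.γ i = e'.γ i) : e = e' := by
  have : e.γ = e'.γ := by
    funext j
    by_cases h : i = j
    · rw [← h, hi]
    · refine hC.unique (e.γ i) _ _ (e.adj i j h) (hi ▸ e'.adj i j h) ?_
      rw [e.spec, e'.spec, hb]
  cases e
  cases e'
  simp_all

lemma ChamberLift.exists_lift (hC : IsCovering (cosetAdj H) adjC f) (i : I) (b : G) (c : C)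
    (hc : f c = CosetVertex.of i b) : ∃ e : ChamberLift adjC f, e.b = b ∧ e.γ i = c := by
  classical
  have key : ∀ j, j ≠ i → ∃ c', adjC c c' ∧ f c' = CosetVertex.of j b := by
    intro j hj
    exact hC.lift c _ (hc ▸ cosetAdj_of hj.symm b)
  have : Nonempty C := ⟨c⟩
  choose! δ hδ hfδ using key
  refine ⟨⟨b, fun j => if j = i then c else δ j, ?_, ?_⟩, rfl, by simp⟩
  · intro j
    by_cases h : j = i
    · subst h; simpa using hc
    · simpa [h] using hfδ j h
  · intro j k hjk
    by_cases hj : j = i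
    · subst hj
      simpa [hjk.symm] using hδ k hjk.symm
    by_cases hk : k = i
    · subst hk
      simpa [hjk] using hC.symm _ _ (hδ j hjk)
    · simp only [hj, hk, if_false]
      refine hC.triangle c _ _ (hδ j hj) (hδ k hk) ?_
      rw [hfδ j hj, hfδ k hk]
      exact cosetAdj_of hjk b

lemma ChamberLift.exists_move (hC : IsCovering (cosetAdj H) adjC f) (i : I) (h : H i)
    (e : ChamberLift adjC f) :
    ∃ e' : ChamberLift adjC f, e'.b = e.b * (h : G)⁻¹ ∧ e'.γ i = e.γ i := by
  refine ChamberLift.exists_lift hC i _ _ ?_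
  rw [e.spec, CosetVertex.of_eq_of]
  simp

/-- The elements of `H i` act on lifted chambers, keeping the vertex of type `i`. -/
noncomputable def ChamberLift.move (hC : IsCovering (cosetAdj H) adjC f) (i : I) (h : H i)
    (e : ChamberLift adjC f) : ChamberLift adjC f := (ChamberLift.exists_move hC i h e).choose

lemma ChamberLift.move_b (hC : IsCovering (cosetAdj H) adjC f) (i : I) (h : H i)
    (e : ChamberLift adjC f) : (e.move hC i h).b = e.b * (h : G)⁻¹ :=
  (ChamberLift.exists_move hC i h e).choose_spec.1

lemma ChamberLift.move_γ (hC : IsCovering (cosetAdj H) adjC f) (i : I) (h : H i)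
    (e : ChamberLift adjC f) : (e.move hC i h).γ i = e.γ i :=
  (ChamberLift.exists_move hC i h e).choose_spec.2

lemma ChamberLift.move_mul (hC : IsCovering (cosetAdj H) adjC f) (i : I) (h h' : H i)
    (e : ChamberLift adjC f) : e.move hC i (h * h') = (e.move hC i h').move hC i h := by
  refine ChamberLift.ext' hC i ?_ ?_
  · simp [move_b, mul_assoc]
  · simp only [move_γ]

lemma ChamberLift.move_one (hC : IsCovering (cosetAdj H) adjC f) (i : I)
    (e : ChamberLift adjC f) : e.move hC i 1 = e :=
  ChamberLift.ext' hC i (by simp [move_b]) (by simp only [move_γ])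

lemma ChamberLift.move_eq_move (hC : IsCovering (cosetAdj H) adjC f) {i j : I} {g : G}
    (hi : g ∈ H i) (hj : g ∈ H j) (e : ChamberLift adjC f) :
    e.move hC i ⟨g, hi⟩ = e.move hC j ⟨g, hj⟩ := by
  refine ChamberLift.ext' hC i (by simp [move_b]) ?_
  rw [move_γ]
  by_cases hij : i = j
  · subst hij; rw [move_γ]
  refine (hC.unique (e.γ j) _ _ ?_ (e.adj j i (Ne.symm hij)) ?_).symm
  · have := (e.move hC j ⟨g, hj⟩).adj j i (Ne.symm hij)
    rwa [move_γ] at this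
  · rw [(e.move hC j ⟨g, hj⟩).spec i, e.spec i, move_b, CosetVertex.of_eq_of]
    simpa using hi

/-- The action of `H i` on lifted chambers. -/
noncomputable def ChamberLift.moveHom (hC : IsCovering (cosetAdj H) adjC f) (i : I) :
    H i →* Equiv.Perm (ChamberLift adjC f) where
  toFun h :=
    { toFun := ChamberLift.move hC i h
      invFun := ChamberLift.move hC i h⁻¹
      left_inv := fun e => by rw [← ChamberLift.move_mul, inv_mul_cancel, ChamberLift.move_one]
      right_inv := fun e => by rw [← ChamberLift.move_mul, mul_inv_cancel, ChamberLift.move_one] }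
  map_one' := Equiv.ext fun e => ChamberLift.move_one hC i e
  map_mul' h h' := Equiv.ext fun e => ChamberLift.move_mul hC i h h' e

/-- `G` is the colimit of the subgroups `H i` and their pairwise intersections. -/
def IsColimit (H : I → Subgroup G) : Prop :=
  ∀ (K : Type u) [Group K] (ψ : ∀ i, H i →* K),
    (∀ i j (g : G) (hi : g ∈ H i) (hj : g ∈ H j), ψ i ⟨g, hi⟩ = ψ j ⟨g, hj⟩) →
      ∃ Ψ : G →* K, ∀ i (h : H i), Ψ h = ψ i h

/-- The coset graph of a colimit has no nontrivial coverings. -/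
theorem hasSections_of_isColimit (hcol : IsColimit H) (hgen : ⨆ i, H i = ⊤) :
    HasSections (cosetAdj H) := by
  intro C adjC f hC c₀
  obtain ⟨Ψ, hΨ⟩ := hcol (Equiv.Perm (ChamberLift adjC f)) (ChamberLift.moveHom hC)
    fun i j g hi hj => Equiv.ext fun e => ChamberLift.move_eq_move hC hi hj e
  have hΨ' : ∀ i (h : H i) e, Ψ h e = e.move hC i h := fun i h e => by rw [hΨ]; rfl
  have hb : ∀ g e, (Ψ g e).b = e.b * g⁻¹ := by
    intro g
    have hg : g ∈ ⨆ i, H i := hgen ▸ Subgroup.mem_top g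
    induction hg using Subgroup.iSup_induction' with
    | hp i g hg => intro e; rw [hΨ' i ⟨g, hg⟩, ChamberLift.move_b]
    | h1 => simp
    | hmul a b _ _ ha hb =>
      intro e
      rw [map_mul, Equiv.Perm.mul_apply, ha, hb]; group
  obtain ⟨b0, hb0⟩ := (f c₀).exists_of
  obtain ⟨e0, he0, hγ0⟩ := ChamberLift.exists_lift hC _ b0 c₀ hb0
  let F : G → ChamberLift adjC f := fun b => Ψ (b⁻¹ * b0) e0
  have hF : ∀ b, (F b).b = b := fun b => by simp only [F, hb, he0]; group
  have hFi : ∀ i b b', b⁻¹ * b' ∈ H i → (F b').γ i = (F b).γ i := by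
    intro i b b' h
    have : F b' = Ψ ((⟨b⁻¹ * b', h⟩⁻¹ : H i) : G) (F b) := by
      simp only [F]
      rw [← Equiv.Perm.mul_apply, ← map_mul]
      congr 2
      simp
    rw [this, hΨ', ChamberLift.move_γ]
  choose r hr using fun v : CosetVertex H => v.exists_of
  have hσ : ∀ i b, (F (r (CosetVertex.of i b))).γ i = (F b).γ i := fun i b => by
    refine hFi i _ _ ?_
    rw [← CosetVertex.of_eq_of]
    exact hr (CosetVertex.of i b) ▸ rfl
  refine ⟨fun v => (F (r v)).γ v.1, ?_, ?_, ?_⟩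
  · have h1 := hσ (f c₀).1 b0
    rw [← hb0] at h1
    change (F (r (f c₀))).γ (f c₀).1 = c₀
    have h0 : F b0 = e0 := by simp [F]
    rw [h1, h0, hγ0]
  · intro v
    exact ((F (r v)).spec v.1).trans (by rw [hF]; exact (hr v).symm)
  · rintro v w ⟨hne, g, hv, hw⟩
    have h1 := hσ v.1 g
    have h2 := hσ w.1 g
    rw [← hv] at h1
    rw [← hw] at h2
    change adjC ((F (r v)).γ v.1) ((F (r w)).γ w.1)
    rw [h1, h2]
    exact (F g).adj _ _ hne

end CosetGraph

section Transfer

variable {V V' : Type*} {adj : V → V → Prop} {adj' : V' → V' → Prop} {good : V → Prop}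
  (R : V → V' → Prop) (hR : ∀ a, good a → ∃ a', R a a')
  (h1 : ∀ a b a' b', R a a' → R b b' → adj a b → adj' a' b')
  (h2 : ∀ a b a' b', R a a' → R b b' → Near adj' a' b' → Near adj a b)

include hR h1 h2

lemma SquareFree.transfer (h : SquareFree adj' fun _ => True) : SquareFree adj good := by
  intro a b c d ha hb hc hd hab hbc hcd hda
  obtain ⟨a', ha⟩ := hR a ha
  obtain ⟨b', hb⟩ := hR b hb
  obtain ⟨c', hc⟩ := hR c hc
  obtain ⟨d', hd⟩ := hR d hd
  exact (h a' b' c' d' trivial trivial trivial trivial (h1 _ _ _ _ ha hb hab)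
    (h1 _ _ _ _ hb hc hbc) (h1 _ _ _ _ hc hd hcd) (h1 _ _ _ _ hd ha hda)).imp
    (h2 _ _ _ _ ha hc) (h2 _ _ _ _ hb hd)

lemma PentagonFree.transfer (h : PentagonFree adj' fun _ => True) : PentagonFree adj good := by
  intro a b c d e ha hb hc hd he hab hbc hcd hde hea
  obtain ⟨a', ha⟩ := hR a ha
  obtain ⟨b', hb⟩ := hR b hb
  obtain ⟨c', hc⟩ := hR c hc
  obtain ⟨d', hd⟩ := hR d hd
  obtain ⟨e', he⟩ := hR e he
  exact (h a' b' c' d' e' trivial trivial trivial trivial trivial (h1 _ _ _ _ ha hb hab)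
    (h1 _ _ _ _ hb hc hbc) (h1 _ _ _ _ hc hd hcd) (h1 _ _ _ _ hd he hde)
    (h1 _ _ _ _ he ha hea)).imp (h2 _ _ _ _ ha hc) (Or.imp (h2 _ _ _ _ hb hd)
    (Or.imp (h2 _ _ _ _ hc he) (Or.imp (h2 _ _ _ _ hd ha) (h2 _ _ _ _ he hb))))

end Transfer

section DihedralRep

/-- The linear map `(x, y) ↦ (x + r y, y)`. -/
noncomputable def shearX : Multiplicative ℝ →* ((ℝ × ℝ) ≃ₗ[ℝ] (ℝ × ℝ)) where
  toFun r :=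
    { toFun := fun v => (v.1 + r.toAdd * v.2, v.2)
      map_add' := fun v w => by ext <;> simp; ring
      map_smul' := fun c v => by ext <;> simp; ring
      invFun := fun v => (v.1 - r.toAdd * v.2, v.2)
      left_inv := fun v => by simp
      right_inv := fun v => by simp }
  map_one' := by ext <;> simp
  map_mul' r r' := LinearEquiv.ext fun v => by ext <;> simp; ring

/-- The linear map `(x, y) ↦ (x, y - r x)`. -/
noncomputable def shearY : Multiplicative ℝ →* ((ℝ × ℝ) ≃ₗ[ℝ] (ℝ × ℝ)) where
  toFun r :=
    { toFun := fun v => (v.1, v.2 - r.toAdd * v.1)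
      map_add' := fun v w => by ext <;> simp; ring
      map_smul' := fun c v => by ext <;> simp; ring
      invFun := fun v => (v.1, v.2 + r.toAdd * v.1)
      left_inv := fun v => by simp
      right_inv := fun v => by simp }
  map_one' := by ext <;> simp
  map_mul' r r' := LinearEquiv.ext fun v => by ext <;> simp; ring

/-- The linear map `(x, y) ↦ (y, -x)`. -/
noncomputable def quarterTurn : (ℝ × ℝ) ≃ₗ[ℝ] (ℝ × ℝ) where
  toFun v := (v.2, -v.1)
  map_add' v w := by ext <;> simp; ring
  map_smul' c v := by ext <;> simp
  invFun v := (-v.2, v.1)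
  left_inv v := by simp
  right_inv v := by simp

lemma shearX_apply (r : ℝ) (v : ℝ × ℝ) :
    shearX (Multiplicative.ofAdd r) v = (v.1 + r * v.2, v.2) := rfl

lemma shearY_apply (r : ℝ) (v : ℝ × ℝ) :
    shearY (Multiplicative.ofAdd r) v = (v.1, v.2 - r * v.1) := rfl

lemma quarterTurn_inv_apply (v : ℝ × ℝ) : quarterTurn⁻¹ v = (-v.2, v.1) := rfl

lemma shearX_zpow_apply (r : ℝ) (i : ℤ) (v : ℝ × ℝ) :
    (shearX (Multiplicative.ofAdd r) ^ i) v = (v.1 + i * r * v.2, v.2) := by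
  rw [← map_zpow, ← ofAdd_zsmul, shearX_apply, zsmul_eq_mul]

lemma shearY_zpow_apply (r : ℝ) (i : ℤ) (v : ℝ × ℝ) :
    (shearY (Multiplicative.ofAdd r) ^ i) v = (v.1, v.2 - i * r * v.1) := by
  rw [← map_zpow, ← ofAdd_zsmul, shearY_apply, zsmul_eq_mul]

lemma altProd_eq_of_swap {S G : Type*} [Group G] (g : S → G) (w : G) (s t : S)
    (hs : w * g s * w⁻¹ = g t) (ht : w * g t * w⁻¹ = g s) (n : ℕ) :
    altProd g s t n = w ^ n * (w⁻¹ * g s) ^ n := by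
  induction n generalizing s t with
  | zero => simp [altProd]
  | succ n ih =>
    rw [altProd_succ', ih t s ht hs, pow_succ w, mul_assoc, mul_assoc]
    congr 1
    have : w⁻¹ * g t = w * (w⁻¹ * g s) * w⁻¹ := by rw [← hs]; group
    rw [this, conj_pow, pow_succ]
    group

lemma pow_succ_apply_of_sq {r : ℝ} (u : (ℝ × ℝ) ≃ₗ[ℝ] (ℝ × ℝ))
    (hu : ∀ v, u (u v) = r • u v - v) (n : ℕ) (v : ℝ × ℝ) :
    (u ^ (n + 1)) v = coef r (n + 1) • u v - coef r n • v := by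
  induction n with
  | zero => simp [coef]
  | succ n ih =>
    rw [pow_succ', LinearEquiv.mul_apply, ih, map_sub, map_smul, map_smul, hu, coef_add_two]
    module

lemma altProd_shear {S : Type*} {m : ℕ} (hm : 2 ≤ m) {r : ℝ}
    (hr : r = 2 * Real.cos (Real.pi / m)) (g : S → ((ℝ × ℝ) ≃ₗ[ℝ] (ℝ × ℝ))) {s t : S}
    (hs : g s = shearX (Multiplicative.ofAdd r)) (ht : g t = shearY (Multiplicative.ofAdd r)) :
    altProd g s t m = altProd g t s m := by
  have h1 : quarterTurn * g s * quarterTurn⁻¹ = g t := by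
    rw [hs, ht]
    refine LinearEquiv.ext fun v => ?_
    simp only [LinearEquiv.mul_apply, quarterTurn_inv_apply, shearX_apply, shearY_apply]
    ext <;> simp [quarterTurn, add_comm, sub_eq_add_neg]
  have h2 : quarterTurn * g t * quarterTurn⁻¹ = g s := by
    rw [hs, ht]
    refine LinearEquiv.ext fun v => ?_
    simp only [LinearEquiv.mul_apply, quarterTurn_inv_apply, shearX_apply, shearY_apply]
    ext <;> simp [quarterTurn]
  obtain ⟨n, rfl⟩ : ∃ n, m = n + 1 := ⟨m - 1, by omega⟩
  rw [altProd_eq_of_swap g _ s t h1 h2, altProd_eq_of_swap g _ t s h2 h1]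
  congr 1
  have c0 : coef r (n + 1) = 0 := hr ▸ coef_self hm
  have c1 : coef r n = 1 := hr ▸ coef_pred (by omega)
  refine LinearEquiv.ext fun v => ?_
  rw [pow_succ_apply_of_sq (r := r), pow_succ_apply_of_sq (r := r), c0, c1]
  · simp
  · intro v
    rw [ht]
    simp only [LinearEquiv.mul_apply, quarterTurn_inv_apply, shearY_apply]
    ext <;> simp
  · intro v
    rw [hs]
    simp only [LinearEquiv.mul_apply, quarterTurn_inv_apply, shearX_apply]
    ext
    · simp [sub_eq_add_neg]
    · simp only [Prod.snd_sub, Prod.smul_snd, smul_eq_mul]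
      ring

variable {S : Type*} [Fintype S] [DecidableEq S] {M : S → S → ℕ∞} [IsLargeType M]

variable (M) in
/-- A generator as an element of a standard parabolic subgroup. -/
def gen (X : Set S) (x : S) (hx : x ∈ X) : StandardParabolic M X :=
  ⟨PresentedGroup.of x, Subgroup.subset_closure ⟨x, hx, rfl⟩⟩

lemma exists_shear_rep {s t : S} (hst : s ≠ t) {m : ℕ} (hm : M s t = m) {r : ℝ}
    (hr : r = 2 * Real.cos (Real.pi / m)) :
    ∃ ρ : StandardParabolic M {s, t} →* ((ℝ × ℝ) ≃ₗ[ℝ] (ℝ × ℝ)),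
      ρ (gen M _ s (by simp)) = shearX (Multiplicative.ofAdd r) ∧
      ρ (gen M _ t (by simp)) = shearY (Multiplicative.ofAdd r) := by
  have hm2 : 2 ≤ m := by
    have := IsLargeType.two_le M hst
    rw [hm] at this
    exact_mod_cast this
  let f : S → ((ℝ × ℝ) ≃ₗ[ℝ] (ℝ × ℝ)) := fun x =>
    if x = s then shearX (Multiplicative.ofAdd r) else shearY (Multiplicative.ofAdd r)
  have hfs : f s = shearX (Multiplicative.ofAdd r) := if_pos rfl
  have hft : f t = shearY (Multiplicative.ofAdd r) := if_neg hst.symm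
  obtain ⟨ρ, hρ⟩ := exists_hom_of_braid (M := M) (X := {s, t}) f (by
    rintro x (rfl | rfl) y (rfl | rfl) hxy k hk
    · exact absurd rfl hxy
    · have : k = m := by rw [hm] at hk; exact_mod_cast hk.symm
      subst this
      exact altProd_shear hm2 hr f hfs hft
    · have : k = m := by rw [IsLargeType.symm (M := M), hm] at hk; exact_mod_cast hk.symm
      subst this
      exact (altProd_shear hm2 hr f hfs hft).symm
    · exact absurd rfl hxy)
  exact ⟨ρ, (hρ s (by simp)).trans hfs, (hρ t (by simp)).trans hft⟩

omit [Fintype S] [DecidableEq S] in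
lemma two_cos_pos {s t : S} (hst : s ≠ t) {m : ℕ} (hm : M s t = m) :
    0 < 2 * Real.cos (Real.pi / m) := by
  have h3 : 3 ≤ m := by
    have := IsLargeType.three_le (M := M) s t hst
    rw [hm] at this
    exact_mod_cast this
  have := coef_pos (k := m) (by omega) (j := 2) (by omega) (by omega)
  simpa [coef] using this

end DihedralRep

section ArtinComplex

universe u

variable {S : Type u} [Fintype S] [DecidableEq S] {M : S → S → ℕ∞} [IsLargeType M]

variable (M) in
/-- The maximal proper standard parabolic subgroups of a standard parabolic subgroup. -/
def maxParabolic (X : Set S) (x : X) : Subgroup (StandardParabolic M X) :=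
  (StandardParabolic M (X \ {x.1})).subgroupOf (StandardParabolic M X)

lemma mem_maxParabolic {X : Set S} {x : X} {g : StandardParabolic M X} :
    g ∈ maxParabolic M X x ↔ (g : ArtinGroup M) ∈ StandardParabolic M (X \ {x.1}) := Iff.rfl

variable (M) in
/-- The cosets of `g` and `h` in two maximal proper parabolic subgroups intersect. -/
def Meet (X : Set S) (x : S) (g : ArtinGroup M) (y : S) (h : ArtinGroup M) : Prop :=
  ∃ k, g⁻¹ * k ∈ StandardParabolic M (X \ {x}) ∧ h⁻¹ * k ∈ StandardParabolic M (X \ {y})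

lemma meet_mul_left {X : Set S} {x y : S} (a g h : ArtinGroup M) :
    Meet M X x (a * g) y (a * h) ↔ Meet M X x g y h := by
  constructor
  · rintro ⟨k, h1, h2⟩
    exact ⟨a⁻¹ * k, by simpa [mul_assoc] using h1, by simpa [mul_assoc] using h2⟩
  · rintro ⟨k, h1, h2⟩
    exact ⟨a * k, by simpa [mul_assoc] using h1, by simpa [mul_assoc] using h2⟩

lemma meet_diff {X : Set S} {x y z : S} {g h : ArtinGroup M}
    (hg : g ∈ StandardParabolic M (X \ {x})) (hh : h ∈ StandardParabolic M (X \ {x})) :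
    Meet M X y g z h ↔ Meet M (X \ {x}) y g z h := by
  have set_eq : ∀ w, (X \ {x}) ∩ (X \ {w}) = (X \ {x}) \ {w} := by
    intro w; ext a; simp only [Set.mem_inter_iff, Set.mem_sdiff]; tauto
  constructor
  · rintro ⟨k, h1, h2⟩
    have e : g⁻¹ * k * (k⁻¹ * h) = g⁻¹ * h := by group
    have h2' : k⁻¹ * h ∈ StandardParabolic M (X \ {z}) := by
      simpa using Subgroup.inv_mem _ h2
    obtain ⟨u, hu, w, hw, huw⟩ := exists_mul_of_mem_mul h1 h2'
      (e ▸ Subgroup.mul_mem _ (Subgroup.inv_mem _ hg) hh)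
    rw [set_eq] at hu hw
    refine ⟨g * u, by simpa using hu, ?_⟩
    have : h⁻¹ * (g * u) = w⁻¹ := by
      have : u = g⁻¹ * h * w⁻¹ := by rw [← e, huw]; group
      rw [this]; group
    rw [this]
    exact Subgroup.inv_mem _ hw
  · rintro ⟨k, h1, h2⟩
    refine ⟨k, StandardParabolic_mono ?_ h1, StandardParabolic_mono ?_ h2⟩ <;>
    · intro a ha; exact ⟨ha.1.1, ha.2⟩

lemma near_of_iff {X : Set S} {x y : X} {g h : StandardParabolic M X} :
    Near (cosetAdj (maxParabolic M X)) (CosetVertex.of x g) (CosetVertex.of y h) ↔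
      Meet M X x g y h := by
  rw [near_iff]
  constructor
  · rintro ⟨k, h1, h2⟩
    exact ⟨k, (CosetVertex.of_eq_of (i := x)).1 h1, (CosetVertex.of_eq_of (i := y)).1 h2⟩
  · rintro ⟨k, h1, h2⟩
    have hk : k ∈ StandardParabolic M X := by
      have := Subgroup.mul_mem _ g.2 (StandardParabolic_mono Set.sdiff_subset h1)
      simpa using this
    exact ⟨⟨k, hk⟩, CosetVertex.of_eq_of.2 h1, CosetVertex.of_eq_of.2 h2⟩

lemma cosetAdj_iff {G I : Type u} [Group G] {H : I → Subgroup G} {v w : CosetVertex H} :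
    cosetAdj H v w ↔ v.1 ≠ w.1 ∧ Near (cosetAdj H) v w := by
  rw [near_iff]; rfl

lemma cosetAdj_of_iff {X : Set S} {x y : X} {g h : StandardParabolic M X} :
    cosetAdj (maxParabolic M X) (CosetVertex.of x g) (CosetVertex.of y h) ↔
      x ≠ y ∧ Meet M X x g y h := by
  rw [cosetAdj_iff, near_of_iff]; rfl

/-- The identification of the link of a vertex with a smaller coset graph. -/
def LinkRel {X : Set S} (x : X) (g : StandardParabolic M X)
    (a : CosetVertex (maxParabolic M X)) (a' : CosetVertex (maxParabolic M (X \ {x.1}))) : Prop :=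
  ∃ (y : S) (hy : y ∈ X \ {x.1}) (h : StandardParabolic M (X \ {x.1})),
    a = CosetVertex.of ⟨y, hy.1⟩ (g * ⟨h, StandardParabolic_mono Set.sdiff_subset h.2⟩) ∧
      a' = CosetVertex.of ⟨y, hy⟩ h

section Link

variable {X : Set S} {x : X} {g : StandardParabolic M X}

lemma LinkRel.exists (a : CosetVertex (maxParabolic M X))
    (ha : cosetAdj (maxParabolic M X) (CosetVertex.of x g) a) : ∃ a', LinkRel x g a a' := by
  obtain ⟨hne, k, h1, h2⟩ := ha
  have hk := mem_maxParabolic.1 ((CosetVertex.of_eq_of (i := x)).1 h1)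
  have hne' : a.1.1 ≠ x.1 := fun h => hne (Subtype.ext h).symm
  refine ⟨CosetVertex.of ⟨a.1.1, a.1.2, hne'⟩ ⟨_, hk⟩, a.1.1, ⟨a.1.2, hne'⟩, ⟨_, hk⟩, ?_, rfl⟩
  refine h2.trans (congrArg (CosetVertex.of a.1) (Subtype.ext ?_))
  simp

lemma LinkRel.near_iff {a b : CosetVertex (maxParabolic M X)}
    {a' b' : CosetVertex (maxParabolic M (X \ {x.1}))} (ha : LinkRel x g a a')
    (hb : LinkRel x g b b') :
    Near (cosetAdj (maxParabolic M X)) a b ↔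
      Near (cosetAdj (maxParabolic M (X \ {x.1}))) a' b' := by
  obtain ⟨y, hy, h, rfl, rfl⟩ := ha
  obtain ⟨z, hz, k, rfl, rfl⟩ := hb
  rw [near_of_iff, near_of_iff, ← meet_diff h.2 k.2]
  exact meet_mul_left _ _ _

lemma LinkRel.adj {a b : CosetVertex (maxParabolic M X)}
    {a' b' : CosetVertex (maxParabolic M (X \ {x.1}))} (ha : LinkRel x g a a')
    (hb : LinkRel x g b b') (h : cosetAdj (maxParabolic M X) a b) :
    cosetAdj (maxParabolic M (X \ {x.1})) a' b' := by
  rw [cosetAdj_iff] at h ⊢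
  refine ⟨fun e => h.1 ?_, (ha.near_iff hb).1 h.2⟩
  obtain ⟨y, hy, h, rfl, rfl⟩ := ha
  obtain ⟨z, hz, k, rfl, rfl⟩ := hb
  exact Subtype.ext (congrArg Subtype.val e :)

end Link

/-- A standard parabolic subgroup that is the colimit of smaller ones. -/
def Ample (M : S → S → ℕ∞) (X : Set S) : Prop :=
  (∀ s ∈ X, ∃ i ∈ X, i ≠ s) ∧
    ∀ s ∈ X, ∀ t ∈ X, s ≠ t → M s t ≠ ⊤ → ∃ i ∈ X, i ≠ s ∧ i ≠ t

lemma gen_mem_maxParabolic {X : Set S} {s : S} (hs : s ∈ X) {i : X} (hi : i.1 ≠ s) :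
    gen M X s hs ∈ maxParabolic M X i :=
  Subgroup.subset_closure ⟨s, ⟨hs, fun h => hi h.symm⟩, rfl⟩

lemma Ample.iSup_eq_top {X : Set S} (hX : Ample M X) : ⨆ i, maxParabolic M X i = ⊤ := by
  rw [eq_top_iff]
  rintro ⟨g, hg⟩ -
  have key : ∀ g ∈ StandardParabolic M X, ∀ hg : g ∈ StandardParabolic M X,
      (⟨g, hg⟩ : StandardParabolic M X) ∈ ⨆ i, maxParabolic M X i := by
    intro g hg
    induction hg using Subgroup.closure_induction with
    | mem g h =>
      obtain ⟨s, hs, rfl⟩ := h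
      intro _
      obtain ⟨i, hi, his⟩ := hX.1 s hs
      exact Subgroup.mem_iSup_of_mem ⟨i, hi⟩ (gen_mem_maxParabolic hs his)
    | one => intro _; exact one_mem _
    | mul a b ha hb iha ihb => intro _; exact mul_mem (iha ha) (ihb hb)
    | inv a ha iha => intro _; exact inv_mem (iha ha)
  exact key g hg hg

lemma altProd_congr {S G : Type*} [Group G] {f g : S → G} {s t : S} (hs : f s = g s)
    (ht : f t = g t) (n : ℕ) : altProd f s t n = altProd g s t n := by
  induction n generalizing s t with
  | zero => simp
  | succ n ih => rw [altProd_succ', altProd_succ', ih ht hs, hs]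

lemma Ample.isColimit {X : Set S} (hX : Ample M X) : IsColimit (maxParabolic M X) := by
  intro K _ ψ hψ
  have key : ∀ s, ∃ a : K, ∀ (hs : s ∈ X) (i : X) (h : gen M X s hs ∈ maxParabolic M X i),
      ψ i ⟨gen M X s hs, h⟩ = a := by
    intro s
    by_cases hs : s ∈ X
    · obtain ⟨i, hi, his⟩ := hX.1 s hs
      exact ⟨ψ ⟨i, hi⟩ ⟨gen M X s hs, gen_mem_maxParabolic hs his⟩, fun _ j h => hψ _ _ _ _ _⟩
    · exact ⟨1, fun h => absurd h hs⟩
  choose f hf using key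
  have hbraid : ∀ x ∈ X, ∀ y ∈ X, x ≠ y → ∀ k : ℕ, M x y = k →
      altProd f x y k = altProd f y x k := by
    intro x hx y hy hxy k hk
    obtain ⟨i, hi, hix, hiy⟩ := hX.2 x hx y hy hxy (hk ▸ ENat.natCast_ne_top k)
    let i' : X := ⟨i, hi⟩
    let G : S → maxParabolic M X i' := fun z =>
      if z = x then ⟨gen M X x hx, gen_mem_maxParabolic hx hix⟩
      else ⟨gen M X y hy, gen_mem_maxParabolic hy hiy⟩
    have hGx : G x = ⟨gen M X x hx, gen_mem_maxParabolic hx hix⟩ := if_pos rfl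
    have hGy : G y = ⟨gen M X y hy, gen_mem_maxParabolic hy hiy⟩ := if_neg hxy.symm
    have e1 : altProd G x y k = altProd G y x k := by
      have inj : Function.Injective
          ((StandardParabolic M X).subtype.comp (maxParabolic M X i').subtype) :=
        Subtype.val_injective.comp Subtype.val_injective
      let ι := (StandardParabolic M X).subtype.comp (maxParabolic M X i').subtype
      apply inj
      rw [map_altProd, map_altProd]
      have hx' : ι (G x) =
        PresentedGroup.of x := by rw [hGx]; rfl
      have hy' : ι (G y) =
        PresentedGroup.of y := by rw [hGy]; rfl
      rw [altProd_congr (f := fun z => ι (G z)) (g := fun x => (PresentedGroup.of x : ArtinGroup M)) hx' hy',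
        altProd_congr (f := fun z => ι (G z)) (g := fun x => (PresentedGroup.of x : ArtinGroup M)) hy' hx']
      exact of_braid hxy hk
    have hx' : ψ i' (G x) = f x := by rw [hGx]; exact hf x hx i' _
    have hy' : ψ i' (G y) = f y := by rw [hGy]; exact hf y hy i' _
    have := congrArg (ψ i') e1
    rw [map_altProd, map_altProd, altProd_congr (f := fun z => ψ i' (G z)) (g := f) hx' hy',
      altProd_congr (f := fun z => ψ i' (G z)) (g := f) hy' hx'] at this
    exact this
  obtain ⟨Ψ, hΨ⟩ := exists_hom_of_braid f hbraid
  refine ⟨Ψ, ?_⟩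
  rintro i ⟨⟨g, hgX⟩, hg⟩
  have key : ∀ g ∈ StandardParabolic M (X \ {i.1}), ∀ (hgX : g ∈ StandardParabolic M X)
      (hg : ⟨g, hgX⟩ ∈ maxParabolic M X i), Ψ ⟨g, hgX⟩ = ψ i ⟨⟨g, hgX⟩, hg⟩ := by
    intro g hg
    induction hg using Subgroup.closure_induction with
    | mem g h =>
      obtain ⟨s, hs, rfl⟩ := h
      intro _ h
      exact (hΨ s hs.1).trans (hf s hs.1 i h).symm
    | one => intro _ _; exact (map_one Ψ).trans (map_one (ψ i)).symm
    | mul a b ha hb iha ihb =>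
      intro _ _
      have ha' := StandardParabolic_mono Set.sdiff_subset ha
      have hb' := StandardParabolic_mono Set.sdiff_subset hb
      have h1 := iha ha' ha
      have h2 := ihb hb' hb
      refine ((map_mul Ψ ⟨a, ha'⟩ ⟨b, hb'⟩).trans ?_).trans
        (map_mul (ψ i) ⟨⟨a, ha'⟩, ha⟩ ⟨⟨b, hb'⟩, hb⟩).symm
      rw [h1, h2]
    | inv a ha iha =>
      intro _ _
      have ha' := StandardParabolic_mono Set.sdiff_subset ha
      refine ((map_inv Ψ ⟨a, ha'⟩).trans ?_).trans (map_inv (ψ i) ⟨⟨a, ha'⟩, ha⟩).symm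
      rw [iha ha' ha]
  exact key g hg hgX hg

end ArtinComplex

section Conditions

universe u

variable {S : Type u} [Fintype S] [DecidableEq S] {M : S → S → ℕ∞} [IsLargeType M]

lemma mem_StandardParabolic_singleton {s : S} {g : ArtinGroup M} :
    g ∈ StandardParabolic M {s} ↔ ∃ i : ℤ, PresentedGroup.of s ^ i = g := by
  rw [StandardParabolic, Set.image_singleton, Subgroup.mem_closure_singleton]

lemma eq_zero_of_zpow_mul_eq_one {s t : S} (hst : s ≠ t) {m : ℕ} (hm : M s t = m) {i j k l : ℤ}
    (h : (PresentedGroup.of s : ArtinGroup M) ^ i * PresentedGroup.of t ^ j *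
      PresentedGroup.of s ^ k * PresentedGroup.of t ^ l = 1) : i = 0 ∨ j = 0 := by
  obtain ⟨ρ, hs, ht⟩ := exists_shear_rep hst hm rfl
  have hr := two_cos_pos hst hm
  set r := 2 * Real.cos (Real.pi / m)
  have h1 : gen M {s, t} s (by simp) ^ i * gen M {s, t} t (by simp) ^ j =
      gen M {s, t} t (by simp) ^ (-l) * gen M {s, t} s (by simp) ^ (-k) := by
    rw [← mul_inv_eq_one]
    apply Subtype.ext
    simpa [gen, mul_assoc] using h
  have h2 := congrArg (fun φ : (ℝ × ℝ) ≃ₗ[ℝ] (ℝ × ℝ) => (φ (1, 0)).1) (congrArg ρ h1)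
  simp only [map_mul, map_zpow, hs, ht, LinearEquiv.mul_apply, shearX_zpow_apply,
    shearY_zpow_apply] at h2
  have h3 : (i : ℝ) * j * (r * r) = 0 := by
    have : (1 : ℝ) + i * r * (0 - j * r * 1) = 1 + -k * r * 0 := by exact_mod_cast h2
    linarith
  simpa [hr.ne'] using h3

lemma squareFree_pair {s t : S} (hst : s ≠ t) {m : ℕ} (hm : M s t = m) {X : Set S}
    (hs : s ∈ X) (hX : X \ {s} = {t}) (hX' : X \ {t} = {s})
    (a b c d : CosetVertex (maxParabolic M X)) (ha : a.1 = ⟨s, hs⟩)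
    (hab : cosetAdj (maxParabolic M X) a b) (hbc : cosetAdj (maxParabolic M X) b c)
    (hcd : cosetAdj (maxParabolic M X) c d) (hda : cosetAdj (maxParabolic M X) d a) :
    Near (cosetAdj (maxParabolic M X)) a c ∨ Near (cosetAdj (maxParabolic M X)) b d := by
  have mem : ∀ x ∈ X, x ≠ s → x = t := fun x hx hxs => by
    have : x ∈ X \ {s} := ⟨hx, hxs⟩
    simpa [hX] using this
  have mem' : ∀ x ∈ X, x ≠ t → x = s := fun x hx hxs => by
    have : x ∈ X \ {t} := ⟨hx, hxs⟩
    simpa [hX'] using this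
  have ht : t ∈ X := by
    have : t ∈ X \ {s} := by simp [hX]
    exact this.1
  have toT : ∀ x y : X, x ≠ y → x = ⟨s, hs⟩ → y = ⟨t, ht⟩ := fun x y hxy hx =>
    Subtype.ext (mem y.1 y.2 fun h => hxy (hx.trans (Subtype.ext h.symm)))
  have toS : ∀ x y : X, x ≠ y → x = ⟨t, ht⟩ → y = ⟨s, hs⟩ := fun x y hxy hx =>
    Subtype.ext (mem' y.1 y.2 fun h => hxy (hx.trans (Subtype.ext h.symm)))
  have hb := toT _ _ hab.1 ha
  have hc := toS _ _ hbc.1 hb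
  have hd := toT _ _ hcd.1 hc
  obtain ⟨-, k1, ha1, hb1⟩ := hab
  obtain ⟨-, k2, hb2, hc2⟩ := hbc
  obtain ⟨-, k3, hc3, hd3⟩ := hcd
  obtain ⟨-, k4, hd4, ha4⟩ := hda
  rw [ha] at ha1 ha4
  rw [hb] at hb1 hb2
  rw [hc] at hc2 hc3
  rw [hd] at hd3 hd4
  have key : ∀ (x : X) (v : CosetVertex (maxParabolic M X)) (k k' : StandardParabolic M X),
      v = CosetVertex.of x k → v = CosetVertex.of x k' →
        (k : ArtinGroup M)⁻¹ * k' ∈ StandardParabolic M (X \ {x.1}) := by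
    intro x v k k' h1 h2
    exact mem_maxParabolic.1 (CosetVertex.of_eq_of.1 (h1.symm.trans h2))
  have e1 := key _ _ _ _ hb1 hb2
  have e2 := key _ _ _ _ hc2 hc3
  have e3 := key _ _ _ _ hd3 hd4
  have e4 := key _ _ _ _ ha4 ha1
  simp only [hX, hX', mem_StandardParabolic_singleton] at e1 e2 e3 e4
  obtain ⟨i, hi⟩ := e1
  obtain ⟨j, hj⟩ := e2
  obtain ⟨k, hk⟩ := e3
  obtain ⟨l, hl⟩ := e4
  rcases eq_zero_of_zpow_mul_eq_one hst hm (i := i) (j := j) (k := k) (l := l)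
    (by rw [hi, hj, hk, hl]; group) with rfl | rfl
  · left; left
    have : k1 = k2 := by
      apply Subtype.ext
      rw [zpow_zero] at hi
      exact (inv_mul_eq_one.1 hi.symm)
    rw [ha1, hc2, this]
  · right; left
    have : k2 = k3 := by
      apply Subtype.ext
      rw [zpow_zero] at hj
      exact (inv_mul_eq_one.1 hj.symm)
    rw [hb2, hd3, this]

lemma squareFree_and_pentagonFree_of_pair {s t : S} (hst : s ≠ t) {m : ℕ} (hm : M s t = m) :
    SquareFree (cosetAdj (maxParabolic M {s, t})) (fun _ => True) ∧
      PentagonFree (cosetAdj (maxParabolic M {s, t})) (fun _ => True) := by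
  have hX : ({s, t} : Set S) \ {s} = {t} := by
    ext x; simp only [Set.mem_sdiff, Set.mem_insert_iff, Set.mem_singleton_iff]
    constructor
    · tauto
    · rintro rfl; exact ⟨Or.inr rfl, hst.symm⟩
  have hX' : ({s, t} : Set S) \ {t} = {s} := by
    ext x; simp only [Set.mem_sdiff, Set.mem_insert_iff, Set.mem_singleton_iff]
    constructor
    · tauto
    · rintro rfl; exact ⟨Or.inl rfl, hst⟩
  constructor
  · intro a b c d _ _ _ _ hab hbc hcd hda
    rcases a.1.2 with h | h
    · exact squareFree_pair hst hm (by simp) hX hX' a b c d (Subtype.ext h) hab hbc hcd hda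
    · refine squareFree_pair hst.symm (by rw [IsLargeType.symm (M := M), hm]) (by simp) hX' hX
        a b c d (Subtype.ext h) hab hbc hcd hda
  · intro a b c d e _ _ _ _ _ hab hbc hcd hde hea
    exfalso
    have type : ∀ v : CosetVertex (maxParabolic M {s, t}), v.1.1 = s ∨ v.1.1 = t := fun v => v.1.2
    have ne : ∀ v w, cosetAdj (maxParabolic M {s, t}) v w → v.1.1 ≠ w.1.1 := fun v w h e =>
      h.1 (Subtype.ext e)
    have h1 := ne _ _ hab
    have h2 := ne _ _ hbc
    have h3 := ne _ _ hcd
    have h4 := ne _ _ hde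
    have h5 := ne _ _ hea
    have ta := type a
    have tb := type b
    have tc := type c
    have td := type d
    have te := type e
    grind

lemma Ample.cases (X : Set S) : Ample M X ∨ (∃ s, X = {s}) ∨
    ∃ s t, s ≠ t ∧ X = {s, t} ∧ ∃ m : ℕ, M s t = m := by
  by_cases h1 : ∀ s ∈ X, ∃ i ∈ X, i ≠ s
  · by_cases h2 : ∀ s ∈ X, ∀ t ∈ X, s ≠ t → M s t ≠ ⊤ → ∃ i ∈ X, i ≠ s ∧ i ≠ t
    · exact Or.inl ⟨h1, h2⟩
    · push Not at h2
      obtain ⟨s, hs, t, ht, hst, hm, h⟩ := h2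
      refine Or.inr (Or.inr ⟨s, t, hst, ?_, (M s t).toNat, (ENat.natCast_toNat hm).symm⟩)
      ext x
      simp only [Set.mem_insert_iff, Set.mem_singleton_iff]
      constructor
      · intro hx
        by_cases hxs : x = s
        · exact Or.inl hxs
        · exact Or.inr (h x hx hxs)
      · rintro (rfl | rfl) <;> assumption
  · push Not at h1
    obtain ⟨s, hs, h⟩ := h1
    exact Or.inr (Or.inl ⟨s, Set.eq_singleton_iff_unique_mem.2 ⟨hs, h⟩⟩)

lemma squareFree_adj {X : Set S} (v : CosetVertex (maxParabolic M X))
    (h : SquareFree (cosetAdj (maxParabolic M (X \ {v.1.1}))) fun _ => True) :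
    SquareFree (cosetAdj (maxParabolic M X)) (cosetAdj (maxParabolic M X) v) := by
  obtain ⟨g, hg⟩ := v.exists_of
  refine SquareFree.transfer (LinkRel v.1 g) (fun a ha => ?_)
    (fun a b a' b' ha hb => ha.adj hb) (fun a b a' b' ha hb => (ha.near_iff hb).2) h
  rw [hg] at ha
  exact LinkRel.exists a ha

lemma pentagonFree_adj {X : Set S} (v : CosetVertex (maxParabolic M X))
    (h : PentagonFree (cosetAdj (maxParabolic M (X \ {v.1.1}))) fun _ => True) :
    PentagonFree (cosetAdj (maxParabolic M X)) (cosetAdj (maxParabolic M X) v) := by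
  obtain ⟨g, hg⟩ := v.exists_of
  refine PentagonFree.transfer (LinkRel v.1 g) (fun a ha => ?_)
    (fun a b a' b' ha hb => ha.adj hb) (fun a b a' b' ha hb => (ha.near_iff hb).2) h
  rw [hg] at ha
  exact LinkRel.exists a ha

theorem squareFree_and_pentagonFree (X : Set S) :
    SquareFree (cosetAdj (maxParabolic M X)) (fun _ => True) ∧
      PentagonFree (cosetAdj (maxParabolic M X)) (fun _ => True) := by
  induction hn : X.ncard using Nat.strong_induction_on generalizing X with
  | _ n ih =>
    have ih' : ∀ x : X, SquareFree (cosetAdj (maxParabolic M (X \ {x.1}))) (fun _ => True) ∧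
        PentagonFree (cosetAdj (maxParabolic M (X \ {x.1}))) (fun _ => True) := fun x =>
      ih _ (hn ▸ Set.ncard_sdiff_singleton_lt_of_mem x.2) _ rfl
    rcases Ample.cases (M := M) X with hX | ⟨s, rfl⟩ | ⟨s, t, hst, rfl, m, hm⟩
    · have hsec := hasSections_of_isColimit hX.isColimit hX.iSup_eq_top
      exact ⟨squareFree_of_hasSections cosetAdj_symm cosetAdj_irrefl
          (fun v => squareFree_adj v (ih' v.1).1) (fun v => pentagonFree_adj v (ih' v.1).2) hsec,
        pentagonFree_of_hasSections cosetAdj_symm cosetAdj_irrefl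
          (fun v => squareFree_adj v (ih' v.1).1) (fun v => pentagonFree_adj v (ih' v.1).2) hsec⟩
    · have h : ∀ a b, ¬ cosetAdj (maxParabolic M {s}) a b := fun a b hab =>
        hab.1 (Subsingleton.elim _ _)
      exact ⟨fun a b _ _ _ _ _ _ hab => absurd hab (h a b),
        fun a b _ _ _ _ _ _ _ _ hab => absurd hab (h a b)⟩
    · exact squareFree_and_pentagonFree_of_pair hst hm

theorem Ample.exists_isRadial {X : Set S} (hX : Ample M X) (p : CosetVertex (maxParabolic M X)) :
    ∃ d, IsRadial (cosetAdj (maxParabolic M X)) p d :=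
  LargeArtin.exists_isRadial cosetAdj_symm cosetAdj_irrefl
    (fun v => squareFree_adj v (squareFree_and_pentagonFree _).1)
    (fun v => pentagonFree_adj v (squareFree_and_pentagonFree _).2)
    (hasSections_of_isColimit hX.isColimit hX.iSup_eq_top) p

end Conditions

section DihedralConjugation

lemma altLetter_not (x : Bool) (n : ℕ) : altLetter (!x) x n = !(altLetter x (!x) n) := by
  rw [altLetter_map (fun b : Bool => !b), Bool.not_not]

lemma altLetter_not_succ (x : Bool) (n : ℕ) :
    altLetter x (!x) (n + 1) = !(altLetter x (!x) n) := by
  rw [altLetter_succ, altLetter_not]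

variable {D : Type*} [Group D]

/-- The alternating products whose rightmost letter is `x`. -/
def altWord (σ : Bool → D) (x : Bool) (n : ℕ) : D := altProd σ x (!x) n

lemma altWord_succ (σ : Bool → D) (x : Bool) (n : ℕ) :
    altWord σ x (n + 1) = σ (altLetter x (!x) n) * altWord σ x n := rfl

lemma altWord_succ' (σ : Bool → D) (x : Bool) (n : ℕ) :
    altWord σ x (n + 1) = altWord σ (!x) n * σ x := by
  rw [altWord, altProd_succ', altWord, Bool.not_not]

/-- Normal forms for the elements of a dihedral Artin group, modulo the elements conjugating
the standard generator `σ c` to a standard generator. The last argument is the leftmost letter. -/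
inductive NormalForm (σ : Bool → D) (m : ℕ) (c : Bool) : D → Bool → Prop
  | base (g : D) (d : Bool) (k : ℕ) (hg : g * σ c * g⁻¹ = σ (!d)) (hk : k + 2 < m) :
      NormalForm σ m c (altWord σ d (k + 1) * g) (altLetter d (!d) k)
  | step (g : D) (d : Bool) (k : ℕ) (hg : NormalForm σ m c g d) (hk : k + 1 < m) :
      NormalForm σ m c (altWord σ d (k + 1) * g) (altLetter d (!d) k)

/-- The elements that conjugate `σ c` to a standard generator, or that have a normal form. -/
def HasNormalForm (σ : Bool → D) (m : ℕ) (c : Bool) (g : D) : Prop :=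
  (∃ d, g * σ c * g⁻¹ = σ d) ∨ ∃ d, NormalForm σ m c g d

variable {σ : Bool → D} {m : ℕ} {c : Bool}

lemma mul_altWord {z : D} {τ : Bool → Bool} (hτ : ∀ x, τ (!x) = !(τ x))
    (hz : ∀ x, z * σ x * z⁻¹ = σ (τ x)) (x : Bool) (n : ℕ) :
    z * altWord σ x n = altWord σ (τ x) n * z := by
  have h := map_altProd (MulAut.conj z).toMonoidHom σ x (!x) n
  have h2 : (fun x => (MulAut.conj z).toMonoidHom (σ x)) = fun x => σ (τ x) := funext hz
  rw [h2, ← altProd_comp σ τ, hτ] at h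
  have h3 : z * altWord σ x n * z⁻¹ = altWord σ (τ x) n := h
  rw [← h3]; group

lemma NormalForm.mul_left {z : D} {τ : Bool → Bool} (hτ : ∀ x, τ (!x) = !(τ x))
    (hz : ∀ x, z * σ x * z⁻¹ = σ (τ x)) {g : D} {d : Bool} (h : NormalForm σ m c g d) :
    NormalForm σ m c (z * g) (τ d) := by
  induction h with
  | base g d k hg hk =>
    rw [← mul_assoc, mul_altWord hτ hz, mul_assoc, altLetter_map τ, hτ]
    refine NormalForm.base _ _ _ ?_ hk
    rw [← hτ, ← hz, ← hg]; group
  | step g d k _ hk ih =>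
    rw [← mul_assoc, mul_altWord hτ hz, mul_assoc, altLetter_map τ, hτ]
    exact NormalForm.step _ _ _ ih hk

lemma HasNormalForm.mul_left {z : D} {τ : Bool → Bool} (hτ : ∀ x, τ (!x) = !(τ x))
    (hz : ∀ x, z * σ x * z⁻¹ = σ (τ x)) {g : D} (h : HasNormalForm σ m c g) :
    HasNormalForm σ m c (z * g) := by
  rcases h with ⟨d, hd⟩ | ⟨d, hd⟩
  · refine Or.inl ⟨τ d, ?_⟩
    rw [← hz, ← hd]; group
  · exact Or.inr ⟨τ d, hd.mul_left hτ hz⟩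

variable {n : ℕ} (hbraid : altWord σ false (n + 1) = altWord σ true (n + 1))

include hbraid

lemma altWord_eq_altWord (x y : Bool) : altWord σ x (n + 1) = altWord σ y (n + 1) := by
  cases x <;> cases y <;> simp [hbraid]

lemma altWord_conj (x : Bool) :
    altWord σ x n * σ (!x) * (altWord σ x n)⁻¹ = σ (altLetter x (!x) n) := by
  rw [mul_inv_eq_iff_eq_mul, ← altWord_succ, altWord_eq_altWord hbraid x (!x), altWord_succ',
    Bool.not_not]

lemma delta_conj (x : Bool) :
    altWord σ false (n + 1) * σ x * (altWord σ false (n + 1))⁻¹ =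
      σ (altLetter (!x) x n) := by
  have h := altWord_conj hbraid (!x)
  rw [Bool.not_not] at h
  rw [altWord_eq_altWord hbraid false x, altWord_succ', ← h]
  group

lemma delta_inv_conj (x : Bool) :
    (altWord σ false (n + 1))⁻¹ * σ x * (altWord σ false (n + 1))⁻¹⁻¹ =
      σ (altLetter (!x) x n) := by
  have h := delta_conj hbraid (altLetter (!x) x n)
  have h2 : altLetter (!(altLetter (!x) x n)) (altLetter (!x) x n) n = x := by
    rw [altLetter_not x, Bool.not_not, altLetter_eq_ite x]
    split_ifs with h0 <;> simp [altLetter_eq_ite, h0]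
  rw [h2] at h
  rw [← h]; group

lemma HasNormalForm.delta_mul {g : D} (h : HasNormalForm σ m c g) :
    HasNormalForm σ m c (altWord σ false (n + 1) * g) :=
  h.mul_left (τ := fun x => altLetter (!x) x n)
    (fun x => by rw [Bool.not_not, altLetter_not x, Bool.not_not]) (delta_conj hbraid)

lemma HasNormalForm.delta_inv_mul {g : D} (h : HasNormalForm σ m c g) :
    HasNormalForm σ m c ((altWord σ false (n + 1))⁻¹ * g) :=
  h.mul_left (τ := fun x => altLetter (!x) x n)
    (fun x => by rw [Bool.not_not, altLetter_not x, Bool.not_not]) (delta_inv_conj hbraid)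

lemma HasNormalForm.gen_mul (hn : 2 ≤ n) {g : D} (h : HasNormalForm σ (n + 1) c g) (x : Bool) :
    HasNormalForm σ (n + 1) c (σ x * g) := by
  rcases h with ⟨d, hd⟩ | ⟨e, he⟩
  · by_cases hx : x = d
    · subst hx
      exact Or.inl ⟨x, by rw [← mul_left_inj (σ x)]; simpa [mul_assoc] using hd⟩
    · have hx' : d = !x := by cases x <;> cases d <;> simp_all
      subst hx'
      have := NormalForm.base (m := n + 1) g x 0 hd (by omega)
      exact Or.inr ⟨_, by simpa [altWord, altProd] using this⟩
  · by_cases hx : x = e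
    · subst hx
      have := NormalForm.step (m := n + 1) g x 0 he (by omega)
      exact Or.inr ⟨_, by simpa [altWord, altProd] using this⟩
    · have hx' : x = !e := by cases x <;> cases e <;> simp_all
      subst hx'
      cases he with
      | base g d k hg hk =>
        rw [← altLetter_not_succ, ← mul_assoc, ← altWord_succ]
        by_cases hk' : k + 1 + 2 < n + 1
        · exact Or.inr ⟨_, NormalForm.base g d (k + 1) hg hk'⟩
        · obtain rfl : n = k + 1 + 1 := by omega
          refine Or.inl ⟨altLetter d (!d) (k + 1 + 1), ?_⟩
          rw [← altWord_conj hbraid, ← hg]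
          group
      | step g d k hg hk =>
        rw [← altLetter_not_succ, ← mul_assoc, ← altWord_succ]
        by_cases hk' : k + 1 + 1 < n + 1
        · exact Or.inr ⟨_, NormalForm.step g d (k + 1) hg hk'⟩
        · obtain rfl : n = k + 1 := by omega
          rw [altWord_eq_altWord hbraid d false]
          exact HasNormalForm.delta_mul hbraid (Or.inr ⟨d, hg⟩)

lemma HasNormalForm.altWord_mul (hn : 2 ≤ n) {g : D} (h : HasNormalForm σ (n + 1) c g) (x : Bool)
    (k : ℕ) : HasNormalForm σ (n + 1) c (altWord σ x k * g) := by
  induction k with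
  | zero => simpa [altWord, altProd] using h
  | succ k ih => rw [altWord_succ, mul_assoc]; exact HasNormalForm.gen_mul hbraid hn ih _

lemma HasNormalForm.gen_inv_mul (hn : 2 ≤ n) {g : D} (h : HasNormalForm σ (n + 1) c g)
    (x : Bool) : HasNormalForm σ (n + 1) c ((σ x)⁻¹ * g) := by
  have : (σ x)⁻¹ * g = (altWord σ false (n + 1))⁻¹ * (altWord σ (!x) n * g) := by
    rw [altWord_eq_altWord hbraid false x, altWord_succ']
    group
  rw [this]
  exact HasNormalForm.delta_inv_mul hbraid (HasNormalForm.altWord_mul hbraid hn h _ _)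

lemma hasNormalForm (hn : 2 ≤ n) (hgen : Subgroup.closure (Set.range σ) = ⊤) (c : Bool) (g : D) :
    HasNormalForm σ (n + 1) c g := by
  have hg : g ∈ Subgroup.closure (Set.range σ) := hgen ▸ Subgroup.mem_top g
  induction hg using Subgroup.closure_induction_left with
  | one => exact Or.inl ⟨c, by simp⟩
  | mul_left x hx y hy ih =>
    obtain ⟨x, rfl⟩ := hx
    exact HasNormalForm.gen_mul hbraid hn ih x
  | inv_mul_cancel x hx y hy ih =>
    obtain ⟨x, rfl⟩ := hx
    exact HasNormalForm.gen_inv_mul hbraid hn ih x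

omit hbraid

/-- Coordinates of the plane adapted to the letter `e`. -/
def planeVec (e : Bool) (x y : ℝ) : ℝ × ℝ := if e then (-y, x) else (x, y)

/-- The basis vector fixed by the generator `e`. -/
def axisVec (e : Bool) : ℝ × ℝ := planeVec e 1 0

lemma planeVec_not (e : Bool) (x : ℝ) : ∃ ε : ℝ, ε ≠ 0 ∧ planeVec (!e) x 0 = ε • planeVec e 0 x := by
  cases e
  · exact ⟨1, by norm_num, by simp [planeVec]⟩
  · exact ⟨-1, by norm_num, by simp [planeVec]⟩

variable {r : ℝ} {ρ : D →* ((ℝ × ℝ) ≃ₗ[ℝ] (ℝ × ℝ))}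
  (hρX : ρ (σ false) = shearX (Multiplicative.ofAdd r))
  (hρY : ρ (σ true) = shearY (Multiplicative.ofAdd r))

include hρX hρY

lemma gen_planeVec (e : Bool) (x y : ℝ) :
    ρ (σ e) (planeVec e x y) = planeVec e (x + r * y) y := by
  cases e
  · rw [hρX, shearX_apply]; simp [planeVec]
  · rw [hρY, shearY_apply]; simp [planeVec]

lemma gen_zpow_axisVec (e : Bool) (k : ℤ) : ρ (σ e ^ k) (axisVec e) = axisVec e := by
  cases e
  · rw [map_zpow, hρX, shearX_zpow_apply]; simp [axisVec, planeVec]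
  · rw [map_zpow, hρY, shearY_zpow_apply]; simp [axisVec, planeVec]

lemma gen_not_planeVec (e : Bool) (x y : ℝ) :
    ∃ ε : ℝ, ε ≠ 0 ∧ ρ (σ (!e)) (planeVec e x y) = ε • planeVec (!e) (r * x - y) x := by
  cases e
  · refine ⟨-1, by norm_num, ?_⟩
    simp only [Bool.not_false, hρY, shearY_apply]
    simp [planeVec]
  · refine ⟨1, by norm_num, ?_⟩
    simp only [Bool.not_true, hρX, shearX_apply]
    simp [planeVec]; ring

lemma altWord_planeVec (d : Bool) (k : ℕ) (x y : ℝ) :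
    ∃ ε : ℝ, ε ≠ 0 ∧ ρ (altWord σ d (k + 1)) (planeVec d x y) =
      ε • planeVec (altLetter d (!d) k) (coef r (k + 2) * y + coef r (k + 1) * x)
        (coef r (k + 1) * y + coef r k * x) := by
  induction k with
  | zero =>
    refine ⟨1, one_ne_zero, ?_⟩
    simp only [altWord, altProd, mul_one, altLetter_zero, gen_planeVec hρX hρY, coef, one_smul]
    congr 1 <;> ring
  | succ k ih =>
    obtain ⟨ε, hε, h⟩ := ih
    obtain ⟨ε', hε', h'⟩ := gen_not_planeVec hρX hρY (altLetter d (!d) k)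
      (coef r (k + 2) * y + coef r (k + 1) * x) (coef r (k + 1) * y + coef r k * x)
    refine ⟨ε * ε', mul_ne_zero hε hε', ?_⟩
    rw [altWord_succ, map_mul, LinearEquiv.mul_apply, h, map_smul, altLetter_not_succ, h', smul_smul]
    congr 2
    rw [coef_add_two r (k + 1), coef_add_two r k]
    ring

/-- The vectors of the plane fixed by a generator lie on its axis. -/
lemma eq_smul_axisVec (hr : r ≠ 0) (e : Bool) (v : ℝ × ℝ) {k : ℤ} (hk : k ≠ 0)
    (h : ρ (σ e ^ k) v = v) : ∃ x : ℝ, v = x • axisVec e := by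
  have hk' : (k : ℝ) ≠ 0 := by exact_mod_cast hk
  cases e
  · rw [map_zpow, hρX, shearX_zpow_apply] at h
    have := congrArg Prod.fst h
    have h2 : v.2 = 0 := by simpa [hr, hk'] using this
    exact ⟨v.1, by ext <;> simp [axisVec, planeVec, h2]⟩
  · rw [map_zpow, hρY, shearY_zpow_apply] at h
    have := congrArg Prod.snd h
    have h2 : v.1 = 0 := by simpa [hr, hk'] using this
    exact ⟨v.2, by ext <;> simp [axisVec, planeVec, h2]⟩

lemma NormalForm.planeVec (hm : 2 ≤ m) (hr : r = 2 * Real.cos (Real.pi / m)) (hr0 : r ≠ 0)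
    {g : D} {e : Bool} (h : NormalForm σ m c g e) :
    ∃ ε x y : ℝ, ε ≠ 0 ∧ 0 < x ∧ 0 < y ∧ ρ g (axisVec c) = ε • planeVec e x y := by
  have pos : ∀ j, 0 < j → j < m → 0 < coef r j := fun j h h' => hr ▸ coef_pos hm h h'
  have nonneg : ∀ j, j ≤ m → 0 ≤ coef r j := fun j h => hr ▸ coef_nonneg hm h
  induction h with
  | base g d k hg hk =>
    have h0 : ρ g (axisVec c) ≠ 0 := by
      rw [Ne, LinearEquiv.map_eq_zero_iff]
      cases c <;> simp [axisVec, LargeArtin.planeVec]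
    obtain ⟨x, hx⟩ := eq_smul_axisVec hρX hρY hr0 (!d) (ρ g (axisVec c)) (k := 1) one_ne_zero (by
      rw [zpow_one, ← hg, map_mul, map_mul, LinearEquiv.mul_apply, LinearEquiv.mul_apply,
        ← LinearEquiv.mul_apply (ρ g⁻¹), ← map_mul, inv_mul_cancel, map_one]
      have := gen_zpow_axisVec hρX hρY c 1
      rw [zpow_one] at this
      exact congrArg (ρ g) this)
    have hx0 : x ≠ 0 := by rintro rfl; simp [hx] at h0
    obtain ⟨ε, hε, h1⟩ := planeVec_not d 1
    obtain ⟨ε', hε', h2⟩ := altWord_planeVec hρX hρY d k 0 1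
    have h3 : ρ (altWord σ d (k + 1) * g) (axisVec c) = (x * ε * ε') • LargeArtin.planeVec
        (altLetter d (!d) k) (coef r (k + 2) * 1 + coef r (k + 1) * 0)
        (coef r (k + 1) * 1 + coef r k * 0) := by
      rw [map_mul, LinearEquiv.mul_apply, hx, axisVec, h1, map_smul, map_smul, h2, smul_smul,
        smul_smul]
    refine ⟨_, _, _, by simp [hx0, hε, hε'], ?_, ?_, h3⟩
    · simpa using pos _ (by omega) hk
    · simpa using pos (k + 1) (by omega) (by omega)
  | step g d k _ hk ih =>
    obtain ⟨ε, x, y, hε, hx, hy, h1⟩ := ih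
    obtain ⟨ε', hε', h2⟩ := altWord_planeVec hρX hρY d k x y
    have h3 : ρ (altWord σ d (k + 1) * g) (axisVec c) = (ε * ε') • LargeArtin.planeVec
        (altLetter d (!d) k) (coef r (k + 2) * y + coef r (k + 1) * x)
        (coef r (k + 1) * y + coef r k * x) := by
      rw [map_mul, LinearEquiv.mul_apply, h1, map_smul, h2, smul_smul]
    refine ⟨_, _, _, by simp [hε, hε'], ?_, ?_, h3⟩
    · have h5 := mul_nonneg (nonneg (k + 2) (by omega)) hy.le
      have h4 := mul_pos (pos (k + 1) (by omega) (by omega)) hx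
      linarith
    · have h5 := mul_pos (pos (k + 1) (by omega) (by omega)) hy
      have h4 := mul_nonneg (nonneg k (by omega)) hx.le
      linarith

/-- Conjugates of standard generators of a dihedral Artin group with a common power coincide. -/
lemma conj_gen_eq_gen (hn : 2 ≤ n) (hbraid : altWord σ false (n + 1) = altWord σ true (n + 1))
    (hgen : Subgroup.closure (Set.range σ) = ⊤)
    (hr : r = 2 * Real.cos (Real.pi / (n + 1 : ℕ))) (hr0 : r ≠ 0) {g : D} {c c' : Bool} {k l : ℤ}
    (hk : k ≠ 0) (h : g * σ c ^ k * g⁻¹ = σ c' ^ l) : g * σ c * g⁻¹ = σ c' := by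
  have ne_one : ∀ (b : Bool) (k : ℤ), k ≠ 0 → σ b ^ k ≠ 1 := by
    intro b k hk h1
    obtain ⟨x, hx⟩ := eq_smul_axisVec hρX hρY hr0 b (axisVec (!b)) hk (by rw [h1, map_one]; rfl)
    have e1 := congrArg Prod.fst hx
    have e2 := congrArg Prod.snd hx
    cases b <;> simp [axisVec, planeVec] at e1 e2
  have key : ∀ {c c' : Bool} {k l : ℤ} {g : D}, k ≠ 0 → g * σ c ^ k * g⁻¹ = σ c' ^ l →
      ∃ x : ℝ, ρ g (axisVec c) = x • axisVec c' := by
    intro c c' k l g hk h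
    have hl : l ≠ 0 := by
      rintro rfl
      rw [zpow_zero, mul_inv_eq_one, mul_eq_left] at h
      exact ne_one c k hk h
    refine eq_smul_axisVec hρX hρY hr0 c' _ hl ?_
    rw [← h, map_mul, map_mul, LinearEquiv.mul_apply, LinearEquiv.mul_apply,
      ← LinearEquiv.mul_apply (ρ g⁻¹), ← map_mul, inv_mul_cancel, map_one]
    exact congrArg (ρ g) (gen_zpow_axisVec hρX hρY c k)
  obtain ⟨x, hx⟩ := key hk h
  rcases hasNormalForm hbraid hn hgen c g with ⟨d, hd⟩ | ⟨d, hd⟩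
  · have hd' : σ d ^ k = σ c' ^ l := by rw [← h, ← hd, conj_zpow]
    by_cases hdc : d = c'
    · rw [hd, hdc]
    · exfalso
      obtain ⟨y, hy⟩ := key (g := 1) hk (by simpa using hd')
      have e1 := congrArg Prod.fst hy
      have e2 := congrArg Prod.snd hy
      cases d <;> cases c' <;> simp_all [axisVec, planeVec]
  · exfalso
    obtain ⟨ε, y, z, hε, hy, hz, h1⟩ := hd.planeVec hρX hρY (by omega) hr hr0
    rw [hx] at h1
    have e1 := congrArg Prod.fst h1
    have e2 := congrArg Prod.snd h1
    cases d <;> cases c' <;> simp [axisVec, planeVec, hε, hy.ne', hz.ne'] at e1 e2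

end DihedralConjugation

section Conj

variable {G : Type*} [Group G]

lemma mem_conjSubgroup {g x : G} {H : Subgroup G} : x ∈ conjSubgroup g H ↔ g⁻¹ * x * g ∈ H := by
  simp only [conjSubgroup, Subgroup.mem_map, MulEquiv.coe_toMonoidHom, MulAut.conj_apply]
  constructor
  · rintro ⟨y, hy, rfl⟩
    simpa [mul_assoc] using hy
  · intro h
    exact ⟨_, h, by group⟩

lemma conjSubgroup_one (H : Subgroup G) : conjSubgroup 1 H = H := by
  ext x; simp [mem_conjSubgroup]

lemma conjSubgroup_mul (g h : G) (H : Subgroup G) :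
    conjSubgroup (g * h) H = conjSubgroup g (conjSubgroup h H) := by
  ext x; simp [mem_conjSubgroup, mul_assoc]

lemma conjSubgroup_inf (g : G) (H K : Subgroup G) :
    conjSubgroup g (H ⊓ K) = conjSubgroup g H ⊓ conjSubgroup g K := by
  ext x; simp [mem_conjSubgroup]

lemma conjSubgroup_bot (g : G) : conjSubgroup g (⊥ : Subgroup G) = ⊥ := Subgroup.map_bot _

lemma conjSubgroup_mono (g : G) {H K : Subgroup G} (h : H ≤ K) :
    conjSubgroup g H ≤ conjSubgroup g K := Subgroup.map_mono h

lemma conjSubgroup_of_mem {g : G} {H : Subgroup G} (hg : g ∈ H) : conjSubgroup g H = H := by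
  ext x
  rw [mem_conjSubgroup, Subgroup.mul_mem_cancel_right _ hg,
    Subgroup.mul_mem_cancel_left _ (H.inv_mem hg)]

end Conj

section PairConj

variable {S : Type*} [Fintype S] [DecidableEq S] {M : S → S → ℕ∞} [IsLargeType M]

/-- Conjugates of the standard generators of a dihedral Artin group of large type generate
subgroups that are equal or intersect trivially. -/
lemma conjSubgroup_inf_of_pair {s t : S} (hst : s ≠ t) {m : ℕ} (hm : M s t = m) {g : ArtinGroup M}
    (hg : g ∈ StandardParabolic M {s, t}) {a b : S} (ha : a ∈ ({s, t} : Set S))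
    (hb : b ∈ ({s, t} : Set S)) :
    conjSubgroup g (StandardParabolic M {a}) ⊓ StandardParabolic M {b} = ⊥ ∨
      conjSubgroup g (StandardParabolic M {a}) = StandardParabolic M {b} := by
  have hm3 : 3 ≤ m := by
    have := IsLargeType.three_le (M := M) s t hst
    rw [hm] at this
    exact_mod_cast this
  obtain ⟨n, rfl⟩ : ∃ n, m = n + 1 := ⟨m - 1, by omega⟩
  obtain ⟨ρ, hρs, hρt⟩ := exists_shear_rep hst hm rfl
  let x : Bool → S := fun c => bif c then t else s
  have hx : ∀ c, x c ∈ ({s, t} : Set S) := by rintro (_ | _) <;> simp [x]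
  let σ : Bool → StandardParabolic M {s, t} := fun c => gen M _ (x c) (hx c)
  have hx' : ∀ c ∈ ({s, t} : Set S), ∃ d, x d = c := by
    rintro c (rfl | rfl)
    · exact ⟨false, rfl⟩
    · exact ⟨true, rfl⟩
  have hbraid : altWord σ false (n + 1) = altWord σ true (n + 1) := by
    have key : ∀ c, ((altWord σ c (n + 1) : StandardParabolic M {s, t}) : ArtinGroup M) =
        altProd (fun y => (PresentedGroup.of y : ArtinGroup M)) (x c) (x (!c)) (n + 1) := by
      intro c
      rw [altProd_comp]
      exact map_altProd (StandardParabolic M {s, t}).subtype σ c (!c) (n + 1)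
    apply Subtype.ext
    rw [key, key]
    exact of_braid hst hm
  have hgen : Subgroup.closure (Set.range σ) = ⊤ := by
    rw [eq_top_iff]
    rintro ⟨y, hy⟩ -
    induction hy using Subgroup.closure_induction with
    | mem y hy =>
      obtain ⟨c, hc, rfl⟩ := hy
      obtain ⟨d, rfl⟩ := hx' c hc
      exact Subgroup.subset_closure ⟨d, rfl⟩
    | one => exact Subgroup.one_mem _
    | mul y z hy hz h1 h2 => exact Subgroup.mul_mem _ h1 h2
    | inv y hy h1 => exact Subgroup.inv_mem _ h1
  obtain ⟨c, rfl⟩ := hx' a ha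
  obtain ⟨d, rfl⟩ := hx' b hb
  by_cases h : conjSubgroup g (StandardParabolic M {x c}) ⊓ StandardParabolic M {x d} = ⊥
  · exact Or.inl h
  right
  obtain ⟨⟨y, hy⟩, hy1⟩ := Subgroup.ne_bot_iff_exists_ne_one.1 h
  obtain ⟨h1, h2⟩ := Subgroup.mem_inf.1 hy
  rw [mem_conjSubgroup, mem_StandardParabolic_singleton] at h1
  rw [mem_StandardParabolic_singleton] at h2
  obtain ⟨k, hk⟩ := h1
  obtain ⟨l, hl⟩ := h2
  have hk' : g * PresentedGroup.of (x c) ^ k * g⁻¹ = PresentedGroup.of (x d) ^ l := by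
    rw [hk, hl]; group
  have hk0 : k ≠ 0 := by
    rintro rfl
    refine hy1 (Subtype.ext ?_)
    change y = 1
    rw [← hl, ← hk', zpow_zero]
    group
  have main := conj_gen_eq_gen (σ := σ) (g := ⟨g, hg⟩) (c := c) (c' := d) hρs hρt (by omega)
    hbraid hgen rfl (two_cos_pos hst hm).ne' hk0 (l := l) (Subtype.ext hk')
  have main' : g * PresentedGroup.of (x c) * g⁻¹ = PresentedGroup.of (x d) :=
    congrArg Subtype.val main
  rw [StandardParabolic, StandardParabolic, conjSubgroup, MonoidHom.map_closure]
  simp only [Set.image_singleton, MulEquiv.coe_toMonoidHom, MulAut.conj_apply]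
  rw [main']

end PairConj

section Radial

variable {V : Type*} {adj : V → V → Prop} {p : V} {d : V → ℕ}

lemma IsRadial.apply_le (hd : IsRadial adj p d) (hs : ∀ v w, adj v w → adj w v) {φ : V → V}
    (hφ : ∀ v w, adj v w → adj (φ v) (φ w)) (hp : φ p = p) (v : V) : d (φ v) ≤ d v := by
  induction hn : d v generalizing v with
  | zero => rw [(hd.eq_zero v).1 hn, hp, (hd.eq_zero p).2 rfl]
  | succ n ih =>
    obtain ⟨w, hw, hwn⟩ := hd.exists_pred v n hn
    exact (hd.le _ _ (hs _ _ (hφ _ _ hw))).trans (Nat.succ_le_succ (ih w hwn))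

end Radial

section RelativeParabolic

universe u

variable {S : Type u} [Fintype S] [DecidableEq S] {M : S → S → ℕ∞} [IsLargeType M]

variable (M) in
/-- `P` is a parabolic subgroup of the standard parabolic subgroup on `X`. -/
def IsParabolicIn (X : Set S) (P : Subgroup (ArtinGroup M)) : Prop :=
  ∃ g ∈ StandardParabolic M X, ∃ Y ⊆ X, P = conjSubgroup g (StandardParabolic M Y)

lemma IsParabolicIn.standard {X Y : Set S} (h : Y ⊆ X) :
    IsParabolicIn M X (StandardParabolic M Y) :=
  ⟨1, one_mem _, Y, h, (conjSubgroup_one _).symm⟩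

lemma IsParabolicIn.bot (X : Set S) : IsParabolicIn M X ⊥ :=
  StandardParabolic_empty (M := M) ▸ IsParabolicIn.standard (Set.empty_subset X)

lemma IsParabolicIn.mono {X X' : Set S} (h : X ⊆ X') {P : Subgroup (ArtinGroup M)}
    (hP : IsParabolicIn M X P) : IsParabolicIn M X' P := by
  obtain ⟨g, hg, Y, hY, rfl⟩ := hP
  exact ⟨g, StandardParabolic_mono h hg, Y, hY.trans h, rfl⟩

lemma IsParabolicIn.conj {X : Set S} {P : Subgroup (ArtinGroup M)} {h : ArtinGroup M}
    (hh : h ∈ StandardParabolic M X) (hP : IsParabolicIn M X P) :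
    IsParabolicIn M X (conjSubgroup h P) := by
  obtain ⟨g, hg, Y, hY, rfl⟩ := hP
  exact ⟨h * g, mul_mem hh hg, Y, hY, (conjSubgroup_mul _ _ _).symm⟩

lemma IsParabolicIn.le {X : Set S} {P : Subgroup (ArtinGroup M)} (hP : IsParabolicIn M X P) :
    P ≤ StandardParabolic M X := by
  obtain ⟨g, hg, Y, hY, rfl⟩ := hP
  exact (conjSubgroup_mono g (StandardParabolic_mono hY)).trans (conjSubgroup_of_mem hg).le

variable (M) in
/-- The parabolic subgroups of the standard parabolic subgroup on `X` are closed under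
intersections, and those lying in a smaller standard parabolic subgroup are parabolic there. -/
structure WellBehaved (X : Set S) : Prop where
  inf : ∀ P Q, IsParabolicIn M X P → IsParabolicIn M X Q → IsParabolicIn M X (P ⊓ Q)
  restrict : ∀ P, ∀ Z ⊆ X, IsParabolicIn M X P → P ≤ StandardParabolic M Z → IsParabolicIn M Z P

lemma WellBehaved.of_ssubset {X : Set S}
    (inf : ∀ g ∈ StandardParabolic M X, ∀ Y ⊂ X, ∀ Z ⊂ X, IsParabolicIn M X
      (conjSubgroup g (StandardParabolic M Y) ⊓ StandardParabolic M Z))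
    (restrict : ∀ g ∈ StandardParabolic M X, ∀ Y ⊂ X, ∀ Z ⊂ X,
      conjSubgroup g (StandardParabolic M Y) ≤ StandardParabolic M Z →
        IsParabolicIn M Z (conjSubgroup g (StandardParabolic M Y))) : WellBehaved M X where
  inf := by
    rintro P Q hP hQ
    have hPX := hP.le
    have hQX := hQ.le
    obtain ⟨g, hg, Y, hY, rfl⟩ := id hP
    obtain ⟨h, hh, Z, hZ, rfl⟩ := id hQ
    rcases hY.eq_or_ssubset with rfl | hY
    · rwa [conjSubgroup_of_mem hg, inf_eq_right.2 hQX]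
    rcases hZ.eq_or_ssubset with rfl | hZ
    · rwa [conjSubgroup_of_mem hh, inf_eq_left.2 hPX]
    have := (inf (h⁻¹ * g) (mul_mem (inv_mem hh) hg) Y hY Z hZ).conj hh
    rwa [conjSubgroup_inf, ← conjSubgroup_mul, mul_inv_cancel_left] at this
  restrict := by
    rintro P Z hZ hP hPZ
    rcases hZ.eq_or_ssubset with rfl | hZ
    · exact hP
    obtain ⟨g, hg, Y, hY, rfl⟩ := id hP
    rcases hY.eq_or_ssubset with rfl | hY
    · rw [conjSubgroup_of_mem hg] at hPZ ⊢
      rw [hPZ.antisymm (StandardParabolic_mono hZ.subset)]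
      exact .standard subset_rfl
    · exact restrict g hg Y hY Z hZ hPZ

lemma WellBehaved.singleton (s : S) : WellBehaved M {s} := by
  have key : ∀ Y : Set S, Y ⊂ {s} → Y = ∅ := fun Y h => Set.ssubset_singleton_iff.1 h
  refine .of_ssubset (fun g _ Y hY Z _ => ?_) (fun g _ Y hY Z _ _ => ?_)
  · rw [key Y hY, StandardParabolic_empty, conjSubgroup_bot, bot_inf_eq]
    exact .bot _
  · rw [key Y hY, StandardParabolic_empty, conjSubgroup_bot]
    exact .bot _

lemma WellBehaved.pair {s t : S} (hst : s ≠ t) {m : ℕ} (hm : M s t = m) :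
    WellBehaved M {s, t} := by
  have key : ∀ Y : Set S, Y ⊂ {s, t} → Y = ∅ ∨ ∃ a ∈ ({s, t} : Set S), Y = {a} := by
    intro Y hY
    rcases Set.subset_pair_iff_eq.1 hY.subset with h | h | h | h
    · exact Or.inl h
    · exact Or.inr ⟨s, by simp, h⟩
    · exact Or.inr ⟨t, by simp, h⟩
    · exact absurd h hY.ne
  refine .of_ssubset (fun g hg Y hY Z hZ => ?_) (fun g hg Y hY Z hZ h => ?_)
  · rcases key Y hY with rfl | ⟨a, ha, rfl⟩
    · rw [StandardParabolic_empty, conjSubgroup_bot, bot_inf_eq]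
      exact .bot _
    rcases key Z hZ with rfl | ⟨b, hb, rfl⟩
    · rw [StandardParabolic_empty, inf_bot_eq]
      exact .bot _
    rcases conjSubgroup_inf_of_pair hst hm hg ha hb with h | h
    · rw [h]
      exact .bot _
    · rw [h, inf_idem]
      exact .standard hZ.subset
  · rcases key Y hY with rfl | ⟨a, ha, rfl⟩
    · rw [StandardParabolic_empty, conjSubgroup_bot]
      exact .bot _
    rcases key Z hZ with rfl | ⟨b, hb, rfl⟩
    · rw [StandardParabolic_empty, le_bot_iff] at h
      rw [h]
      exact .bot _
    rcases conjSubgroup_inf_of_pair hst hm hg ha hb with h' | h'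
    · rw [inf_eq_left.2 h] at h'
      rw [h']
      exact .bot _
    · rw [h']
      exact .standard subset_rfl

variable (M) in
/-- `P` is a parabolic subgroup of the stabiliser of the coset of `g` of type `x`. -/
def IsParabolicAt (X : Set S) (x : S) (g : ArtinGroup M) (P : Subgroup (ArtinGroup M)) : Prop :=
  ∃ Q, IsParabolicIn M (X \ {x}) Q ∧ P = conjSubgroup g Q

lemma IsParabolicAt.congr {X : Set S} {x : S} {g h : ArtinGroup M} {P : Subgroup (ArtinGroup M)}
    (hP : IsParabolicAt M X x g P) (hgh : h⁻¹ * g ∈ StandardParabolic M (X \ {x})) :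
    IsParabolicAt M X x h P := by
  obtain ⟨Q, hQ, rfl⟩ := hP
  exact ⟨_, hQ.conj hgh, by rw [← conjSubgroup_mul, mul_inv_cancel_left]⟩

lemma CosetVertex.of_eq_iff {X : Set S} {x : X} {g h : StandardParabolic M X} :
    (CosetVertex.of x g : CosetVertex (maxParabolic M X)) = CosetVertex.of x h ↔
      (g : ArtinGroup M)⁻¹ * h ∈ StandardParabolic M (X \ {x.1}) :=
  CosetVertex.of_eq_of

lemma cosetAdj_mul_left {X : Set S} (h : StandardParabolic M X) {x y : X}
    {g k : StandardParabolic M X}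
    (H : cosetAdj (maxParabolic M X) (CosetVertex.of x g) (CosetVertex.of y k)) :
    cosetAdj (maxParabolic M X) (CosetVertex.of x (h * g)) (CosetVertex.of y (h * k)) := by
  rw [cosetAdj_of_iff] at H ⊢
  exact ⟨H.1, (meet_mul_left _ _ _).2 H.2⟩

/-- Left translation of the coset graph. -/
noncomputable def translate {X : Set S} (h : StandardParabolic M X) (v : CosetVertex (maxParabolic M X)) :
    CosetVertex (maxParabolic M X) := CosetVertex.of v.1 (h * v.exists_of.choose)

lemma translate_of {X : Set S} (h : StandardParabolic M X) (x : X) (g : StandardParabolic M X) :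
    translate h (CosetVertex.of x g) = CosetVertex.of x (h * g) := by
  have e := (CosetVertex.of x g : CosetVertex (maxParabolic M X)).exists_of.choose_spec
  refine (CosetVertex.of_eq_iff (x := x)).2 ?_
  have := (CosetVertex.of_eq_iff (x := x)).1 e.symm
  simpa [mul_assoc] using this

lemma cosetAdj_translate {X : Set S} (h : StandardParabolic M X)
    (v w : CosetVertex (maxParabolic M X)) (H : cosetAdj (maxParabolic M X) v w) :
    cosetAdj (maxParabolic M X) (translate h v) (translate h w) := by
  obtain ⟨g, hg⟩ := v.exists_of
  obtain ⟨k, hk⟩ := w.exists_of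
  rw [hg, hk] at H ⊢
  rw [translate_of, translate_of]
  exact cosetAdj_mul_left h H

lemma translate_of_eq_self {X : Set S} {h : StandardParabolic M X} {x : X}
    {g : StandardParabolic M X} (H : (h : ArtinGroup M) ∈
      conjSubgroup (g : ArtinGroup M) (StandardParabolic M (X \ {x.1}))) :
    translate h (CosetVertex.of x g) = CosetVertex.of x g := by
  rw [translate_of, eq_comm, CosetVertex.of_eq_iff]
  rw [mem_conjSubgroup] at H
  simpa [mul_assoc] using H

lemma IsRadial.apply_translate {X : Set S} {p : CosetVertex (maxParabolic M X)}
    {d : CosetVertex (maxParabolic M X) → ℕ} (hd : IsRadial (cosetAdj (maxParabolic M X)) p d)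
    {h : StandardParabolic M X} (hp : translate h p = p) (v : CosetVertex (maxParabolic M X)) :
    d (translate h v) = d v := by
  have inv : ∀ v : CosetVertex (maxParabolic M X), translate h⁻¹ (translate h v) = v := by
    intro v
    obtain ⟨g, hg⟩ := v.exists_of
    rw [hg, translate_of, translate_of, inv_mul_cancel_left]
  refine le_antisymm (hd.apply_le cosetAdj_symm (cosetAdj_translate h) hp v) ?_
  have := hd.apply_le cosetAdj_symm (cosetAdj_translate h⁻¹) (by rw [← hp, inv, hp])
    (translate h v)
  rwa [inv] at this

/-- An element that fixes the centre and a vertex fixes any predecessor of that vertex. -/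
lemma IsRadial.mem_of_fix {X : Set S} {p : CosetVertex (maxParabolic M X)}
    {d : CosetVertex (maxParabolic M X) → ℕ} (hd : IsRadial (cosetAdj (maxParabolic M X)) p d)
    {x y : X} (hxy : x ≠ y) {h k : StandardParabolic M X}
    (hk : d (CosetVertex.of x k) = d (CosetVertex.of y k) + 1) (hp : translate h p = p)
    (hv : (h : ArtinGroup M) ∈
      conjSubgroup (k : ArtinGroup M) (StandardParabolic M (X \ {x.1}))) :
    (h : ArtinGroup M) ∈ conjSubgroup (k : ArtinGroup M) (StandardParabolic M (X \ {y.1})) := by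
  have hv' := translate_of_eq_self hv
  have adj : cosetAdj (maxParabolic M X) (CosetVertex.of y k) (CosetVertex.of x k) :=
    cosetAdj_of hxy.symm k
  have adj' := cosetAdj_translate h _ _ adj
  rw [hv'] at adj'
  have hd' := hd.apply_translate hp (CosetVertex.of y k)
  rcases hd.clique _ _ _ adj adj' hk (by rw [hd', hk]) with e | e
  · rw [translate_of, CosetVertex.of_eq_iff] at e
    rw [mem_conjSubgroup]
    simpa [mul_assoc] using e
  · exact absurd rfl e.1

lemma inf_conjSubgroup_of_isRadial {X : Set S} (ih : ∀ x ∈ X, WellBehaved M (X \ {x}))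
    {x₀ : X} {g₀ : StandardParabolic M X} {d : CosetVertex (maxParabolic M X) → ℕ}
    (hd : IsRadial (cosetAdj (maxParabolic M X)) (CosetVertex.of x₀ g₀) d) (n : ℕ) (x : X)
    (g : StandardParabolic M X) (hn : d (CosetVertex.of x g) = n) (P : Subgroup (ArtinGroup M))
    (hP : IsParabolicAt M X x g P) :
    IsParabolicAt M X x₀ g₀
      (P ⊓ conjSubgroup (g₀ : ArtinGroup M) (StandardParabolic M (X \ {x₀.1}))) := by
  induction n generalizing x g P with
  | zero =>
    have e := (hd.eq_zero _).1 hn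
    obtain rfl : x = x₀ := congrArg Sigma.fst e
    have hP' := hP.congr (CosetVertex.of_eq_iff.1 e.symm)
    obtain ⟨Q, hQ, rfl⟩ := id hP'
    rwa [inf_eq_left.2 (conjSubgroup_mono _ hQ.le)]
  | succ n ih' =>
    obtain ⟨w, ⟨hne, k, hw, hv⟩, hdw⟩ := hd.exists_pred _ n hn
    have hv : (CosetVertex.of x g : CosetVertex (maxParabolic M X)) = CosetVertex.of x k := hv
    rw [hv] at hn
    obtain ⟨Q, hQ, rfl⟩ := hP.congr (CosetVertex.of_eq_iff.1 hv.symm)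
    have hne : w.1 ≠ x := hne
    rw [hw] at hdw
    have hle : conjSubgroup (k : ArtinGroup M) Q ⊓
        conjSubgroup (g₀ : ArtinGroup M) (StandardParabolic M (X \ {x₀.1})) ≤
        conjSubgroup (k : ArtinGroup M) (StandardParabolic M (X \ {w.1.1})) := by
      rintro h ⟨h1, h2⟩
      have h3 := conjSubgroup_mono _ hQ.le h1
      have hX : h ∈ StandardParabolic M X := by
        rw [← conjSubgroup_of_mem k.2]
        exact conjSubgroup_mono _ (StandardParabolic_mono Set.sdiff_subset) h3
      exact hd.mem_of_fix (h := ⟨h, hX⟩) hne.symm (by rw [hn, hdw]) (translate_of_eq_self h2) h3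
    have hxy : x.1 ≠ w.1.1 := fun e => hne (Subtype.ext e).symm
    have hsub : (X \ {x.1}) \ {w.1.1} ⊆ X \ {w.1.1} := fun z hz => ⟨hz.1.1, hz.2⟩
    have hQ' : IsParabolicIn M (X \ {w.1.1})
        (Q ⊓ StandardParabolic M ((X \ {x.1}) \ {w.1.1})) :=
      ((ih x x.2).restrict _ _ Set.sdiff_subset
        ((ih x x.2).inf _ _ hQ (.standard Set.sdiff_subset)) inf_le_right).mono hsub
    have key := ih' w.1 k hdw _ ⟨_, hQ', rfl⟩
    convert key using 1
    refine le_antisymm (le_inf ?_ inf_le_right)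
      (inf_le_inf_right _ (conjSubgroup_mono _ inf_le_left))
    have hset : (X \ {x.1}) ∩ (X \ {w.1.1}) = (X \ {x.1}) \ {w.1.1} := by
      ext z; simp only [Set.mem_inter_iff, Set.mem_sdiff]; tauto
    rw [← hset, ← StandardParabolic_inf, ← inf_assoc, inf_eq_left.2 hQ.le, conjSubgroup_inf]
    exact le_inf inf_le_left hle

lemma Ample.inf_conjSubgroup {X : Set S} (hX : Ample M X) (ih : ∀ x ∈ X, WellBehaved M (X \ {x}))
    {g : ArtinGroup M} (hg : g ∈ StandardParabolic M X) {Y : Set S} (hY : Y ⊂ X) {z : S}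
    (hz : z ∈ X) :
    IsParabolicIn M (X \ {z})
      (conjSubgroup g (StandardParabolic M Y) ⊓ StandardParabolic M (X \ {z})) := by
  obtain ⟨x, hx, hxY⟩ := Set.exists_of_ssubset hY
  obtain ⟨d, hd⟩ := hX.exists_isRadial (CosetVertex.of ⟨z, hz⟩ 1)
  have hYx : Y ⊆ X \ {x} := fun y hy => ⟨hY.subset hy, fun e => hxY (e ▸ hy)⟩
  obtain ⟨Q, hQ, e⟩ := inf_conjSubgroup_of_isRadial ih hd _ ⟨x, hx⟩ ⟨g, hg⟩ rfl
    (conjSubgroup g (StandardParabolic M Y)) ⟨_, .standard hYx, rfl⟩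
  rw [OneMemClass.coe_one, conjSubgroup_one, conjSubgroup_one] at e
  rwa [e]

lemma Ample.wellBehaved {X : Set S} (hX : Ample M X) (ih : ∀ x ∈ X, WellBehaved M (X \ {x})) :
    WellBehaved M X := by
  have sub : ∀ Z ⊂ X, ∃ z ∈ X, Z ⊆ X \ {z} := fun Z hZ =>
    (Set.exists_of_ssubset hZ).imp fun z hz =>
      ⟨hz.1, fun y hy => ⟨hZ.subset hy, fun e => hz.2 (e ▸ hy)⟩⟩
  refine .of_ssubset (fun g hg Y hY Z hZ => ?_) (fun g hg Y hY Z hZ h => ?_)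
  · obtain ⟨z, hz, hZz⟩ := sub Z hZ
    have := ((ih z hz).inf _ _ (hX.inf_conjSubgroup ih hg hY hz) (.standard hZz)).mono
      Set.sdiff_subset
    rwa [inf_assoc, inf_eq_right.2 (StandardParabolic_mono hZz)] at this
  · obtain ⟨z, hz, hZz⟩ := sub Z hZ
    refine (ih z hz).restrict _ _ hZz ?_ h
    have := hX.inf_conjSubgroup ih hg hY hz
    rwa [inf_eq_left.2 (h.trans (StandardParabolic_mono hZz))] at this

theorem wellBehaved (X : Set S) : WellBehaved M X := by
  induction hn : X.ncard using Nat.strong_induction_on generalizing X with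
  | _ n ih =>
    rcases Ample.cases (M := M) X with hX | ⟨s, rfl⟩ | ⟨s, t, hst, rfl, m, hm⟩
    · exact hX.wellBehaved fun x hx => ih _ (hn ▸ Set.ncard_sdiff_singleton_lt_of_mem hx) _ rfl
    · exact .singleton s
    · exact .pair hst hm

omit [Fintype S] [DecidableEq S] [IsLargeType M] in
lemma StandardParabolic_univ : StandardParabolic M Set.univ = ⊤ := by
  rw [StandardParabolic, Set.image_univ]
  exact PresentedGroup.closure_range_of _

omit [Fintype S] [DecidableEq S] [IsLargeType M] in
lemma isParabolicIn_univ {P : Subgroup (ArtinGroup M)} :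
    IsParabolicIn M Set.univ P ↔ IsParabolic M P := by
  simp [IsParabolicIn, IsParabolic, StandardParabolic_univ]

theorem isParabolic_iInf {ι : Type*} (P : ι → Subgroup (ArtinGroup M))
    (hP : ∀ i, IsParabolic M (P i)) : IsParabolic M (⨅ i, P i) := by
  have hex : ∃ n, ∃ (g : ArtinGroup M) (Y : Set S), Y.ncard = n ∧
      ⨅ i, P i ≤ conjSubgroup g (StandardParabolic M Y) :=
    ⟨_, 1, Set.univ, rfl, by rw [conjSubgroup_one, StandardParabolic_univ]; exact le_top⟩
  classical
  obtain ⟨g, Y, hYn, hle⟩ := Nat.find_spec hex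
  refine ⟨g, Y, le_antisymm hle (le_iInf fun i => ?_)⟩
  have h1 : IsParabolicIn M Set.univ (conjSubgroup g⁻¹ (P i)) :=
    (isParabolicIn_univ.2 (hP i)).conj (by rw [StandardParabolic_univ]; exact Subgroup.mem_top _)
  obtain ⟨k, hk, Y', hY', e⟩ := (wellBehaved (M := M) Set.univ).restrict _ Y (Set.subset_univ _)
    ((wellBehaved Set.univ).inf _ _ (.standard (Set.subset_univ Y)) h1) inf_le_left
  have e' : conjSubgroup g (StandardParabolic M Y) ⊓ P i =
      conjSubgroup (g * k) (StandardParabolic M Y') := by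
    rw [conjSubgroup_mul, ← e, conjSubgroup_inf, ← conjSubgroup_mul, mul_inv_cancel,
      conjSubgroup_one]
  have hmin := Nat.find_min' hex ⟨g * k, Y', rfl, e' ▸ le_inf hle (iInf_le _ i)⟩
  obtain rfl := Set.eq_of_subset_of_ncard_le hY' (hYn.trans_le hmin) (Set.toFinite _)
  rw [conjSubgroup_mul, conjSubgroup_of_mem hk] at e'
  exact inf_eq_left.1 e'

end RelativeParabolic

end LargeArtin

/-- In a large-type Artin group, the intersection of an arbitrary (possibly infinite,
possibly empty) family of parabolic subgroups is itself a parabolic subgroup.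
(The empty intersection is the whole group, which is parabolic with $S' = S$.) -/
theorem intersection_of_arbitrary_family_of_parabolics {S : Type*} [Finite S]
    (M : S → S → ℕ∞)
    (hsymm : ∀ s t : S, M s t = M t s)
    (hlarge : ∀ s t : S, s ≠ t → 3 ≤ M s t)
    {ι : Type*} (P : ι → Subgroup (ArtinGroup M))
    (hP : ∀ i, IsParabolic M (P i)) :
    IsParabolic M (⨅ i, P i) := by
  cases nonempty_fintype S
  classical
  have : LargeArtin.IsLargeType M := ⟨hsymm, hlarge⟩
  exact LargeArtin.isParabolic_iInf P hP
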